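/- The subspace W of the bar complex B(A,B,C) is an ideal with respect to the shuffle product; consequently the shuffle product descends to a product on Chen's normalized bar complex B̄(A,B,C) = B(A,B,C)/W, making B̄(A,B,C) a kCDGA. -/

import Mathlib

/-! Commutative differential graded algebras over a field `k` of characteristic zero. -/

structure CDGA (k : Type) [Field k] : Type 1 where
  carrier : Type
  [ring : Ring carrier]
  [algebra : Algebra k carrier]
  grading : ℕ → Submodule k carrier
  [gradedAlgebra : GradedAlgebra grading]
  gcomm : ∀ {m n : ℕ} {x y : carrier}, x ∈ grading m → y ∈ grading n →
      x * y = ((-1 : k) ^ (m * n)) • (y * x)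
  d : carrier →ₗ[k] carrier
  d_mem : ∀ {n : ℕ} {x : carrier}, x ∈ grading n → d x ∈ grading (n + 1)
  d_sq : ∀ x, d (d x) = 0
  leibniz : ∀ {m : ℕ} (x y : carrier), x ∈ grading m →
      d (x * y) = d x * y + ((-1 : k) ^ m) • (x * d y)
  aug : carrier →ₐ[k] k
  h0 : ∀ x ∈ grading 0, d x = 0 → ∃ c : k, x = algebraMap k carrier c

attribute [instance] CDGA.ring CDGA.algebra CDGA.gradedAlgebra

variable {k : Type} [Field k]

/-- Morphisms of kCDGA's. -/
structure CDGAHom (A B : CDGA k) where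
  toHom : A.carrier →ₐ[k] B.carrier
  map_mem : ∀ {n : ℕ} {x : A.carrier}, x ∈ A.grading n → toHom x ∈ B.grading n
  map_d : ∀ x, toHom (A.d x) = B.d (toHom x)

def CDGAHom.comp {A B C : CDGA k} (g : CDGAHom B C) (f : CDGAHom A B) : CDGAHom A C where
  toHom := g.toHom.comp f.toHom
  map_mem := fun h => g.map_mem (f.map_mem h)
  map_d := fun x => by
    simp only [AlgHom.comp_apply]
    rw [f.map_d, g.map_d]

/-- A quasi-isomorphism of kCDGA's: induces an isomorphism on cohomology in every degree. -/
def IsQuasiIso {A B : CDGA k} (f : CDGAHom A B) : Prop :=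
  ∀ n : ℕ,
    (∀ y ∈ B.grading n, B.d y = 0 → ∃ x ∈ A.grading n, A.d x = 0 ∧
        ∃ z ∈ B.grading (n - 1), f.toHom x - y = B.d z) ∧
    (∀ x ∈ A.grading n, A.d x = 0 → (∃ z ∈ B.grading (n - 1), f.toHom x = B.d z) →
        ∃ w ∈ A.grading (n - 1), x = A.d w)

/-- `H¹(B) = 0`. -/
def H1Trivial (B : CDGA k) : Prop :=
  ∀ x ∈ B.grading 1, B.d x = 0 → ∃ y ∈ B.grading 0, x = B.d y
/-- `A` is the free graded-commutative `k`-algebra on homogeneous generators `g i` of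
degrees `deg i` (universal property of the free graded-commutative algebra, differential
disregarded). -/
def IsFreeGCOn (A : CDGA k) {I : Type} (deg : I → ℕ) (g : I → A.carrier) : Prop :=
  (∀ i, g i ∈ A.grading (deg i)) ∧
  ∀ (C : CDGA k) (f : I → C.carrier), (∀ i, f i ∈ C.grading (deg i)) →
    ∃! φ : A.carrier →ₐ[k] C.carrier,
      (∀ i, φ (g i) = f i) ∧ ∀ (n : ℕ) (x : A.carrier), x ∈ A.grading n → φ x ∈ C.grading n

/-- `A` is free as a graded-commutative `k`-algebra. -/
def IsFreeGC (A : CDGA k) : Prop :=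
  ∃ (I : Type) (deg : I → ℕ) (g : I → A.carrier), IsFreeGCOn A deg g

/-- A KS complex: free graded-commutative on a well-ordered set of generators, the
differential of each generator lying in the subalgebra generated by strictly smaller ones. -/
def IsKS (A : CDGA k) : Prop :=
  ∃ (I : Type) (lt : I → I → Prop) (_ : IsWellOrder I lt) (deg : I → ℕ) (g : I → A.carrier),
    IsFreeGCOn A deg g ∧ ∀ i : I, A.d (g i) ∈ Algebra.adjoin k (g '' {j | lt j i})

/-- The differential takes values in the decomposables (products of positive-degree elements). -/
def IsDecomposable (A : CDGA k) : Prop :=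
  ∀ x, A.d x ∈ Submodule.span k {z : A.carrier | ∃ (m n : ℕ) (u v : A.carrier),
      0 < m ∧ 0 < n ∧ u ∈ A.grading m ∧ v ∈ A.grading n ∧ z = u * v}

/-- A minimal kCDGA: free graded-commutative (on positive-degree generators) with
decomposable differential. -/
def IsMinimal (A : CDGA k) : Prop :=
  (∃ (I : Type) (deg : I → ℕ) (g : I → A.carrier), (∀ i, 0 < deg i) ∧ IsFreeGCOn A deg g) ∧
  IsDecomposable A

/-- Data exhibiting a kCDGA as `A ⊗ Λ(t, dt)`, the path object used to define homotopies:
`t` is a degree-zero generator, free over `A` together with `dt` (universal property), with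
the two evaluations `t = 0` and `t = 1`. -/
structure PathData (A : CDGA k) where
  P : CDGA k
  incl : CDGAHom A P
  t : P.carrier
  t_mem : t ∈ P.grading 0
  ev0 : CDGAHom P A
  ev1 : CDGAHom P A
  ev0_incl : ∀ a, ev0.toHom (incl.toHom a) = a
  ev1_incl : ∀ a, ev1.toHom (incl.toHom a) = a
  ev0_t : ev0.toHom t = 0
  ev1_t : ev1.toHom t = 1
  univ : ∀ (Q : CDGA k) (φ : CDGAHom A Q) (u : Q.carrier), u ∈ Q.grading 0 →
      ∃! ψ : CDGAHom P Q, (∀ a, ψ.toHom (incl.toHom a) = φ.toHom a) ∧ ψ.toHom t = u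

/-- Homotopy of kCDGA morphisms, via a path object `A ⊗ Λ(t, dt)`. -/
def Homotopic {M A : CDGA k} (f g : CDGAHom M A) : Prop :=
  ∃ (PD : PathData A) (H : CDGAHom M PD.P),
    (∀ x, PD.ev0.toHom (H.toHom x) = f.toHom x) ∧
    (∀ x, PD.ev1.toHom (H.toHom x) = g.toHom x)

/-- Formality of a kCDGA: quasi-isomorphisms `A ← M(A) → H(A)`, where `H(A)` is (isomorphic
to) the cohomology of `A`, i.e. carries the zero differential. -/
def IsFormal (A : CDGA k) : Prop :=
  ∃ M Z : CDGA k, IsMinimal M ∧ Z.d = 0 ∧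
    (∃ f : CDGAHom M A, IsQuasiIso f) ∧ ∃ g : CDGAHom M Z, IsQuasiIso g

/-- `f : B → A` and `g : B → C` are compatibly formal: there is a homotopy commutative
diagram with rows `A ← B → C`, `M(A) ← M(B) → M(C)` (minimal models) and
`H(A) ← H(B) → H(C)` (zero differentials), all vertical maps quasi-isomorphisms. -/
def CompatiblyFormal {A B C : CDGA k} (f : CDGAHom B A) (g : CDGAHom B C) : Prop :=
  ∃ (MA MB MC HA HB HC : CDGA k)
    (mf : CDGAHom MB MA) (mg : CDGAHom MB MC)
    (hf : CDGAHom HB HA) (hg : CDGAHom HB HC)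
    (ρA : CDGAHom MA A) (ρB : CDGAHom MB B) (ρC : CDGAHom MC C)
    (σA : CDGAHom MA HA) (σB : CDGAHom MB HB) (σC : CDGAHom MC HC),
    IsMinimal MA ∧ IsMinimal MB ∧ IsMinimal MC ∧
    HA.d = 0 ∧ HB.d = 0 ∧ HC.d = 0 ∧
    IsQuasiIso ρA ∧ IsQuasiIso ρB ∧ IsQuasiIso ρC ∧
    IsQuasiIso σA ∧ IsQuasiIso σB ∧ IsQuasiIso σC ∧
    Homotopic (f.comp ρB) (ρA.comp mf) ∧ Homotopic (g.comp ρB) (ρC.comp mg) ∧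
    Homotopic (hf.comp σB) (σA.comp mf) ∧ Homotopic (hg.comp σB) (σC.comp mg)
/-! List helpers for the bar complex. -/

/-- Apply `f` to the entry at (0-indexed) position `i`. -/
def modifyAt {α : Type} (f : α → α) : List α → ℕ → List α
  | [], _ => []
  | a :: t, 0 => f a :: t
  | a :: t, n + 1 => a :: modifyAt f t n

/-- Merge the entries at (0-indexed) positions `i` and `i+1` using `mul`. -/
def mergeAt {α : Type} (mul : α → α → α) : List α → ℕ → List α
  | a :: b :: t, 0 => mul a b :: t
  | a :: t, n + 1 => a :: mergeAt mul t n
  | l, _ => l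

/-- Insert `x` at (0-indexed) position `i`. -/
def insertAt {α : Type} (x : α) : ℕ → List α → List α
  | 0, l => x :: l
  | _ + 1, [] => [x]
  | n + 1, a :: t => a :: insertAt x n t

/-- Interleave two lists: at each position `i` (starting from the given counter), take the
next entry of the first list when `f i = true`, of the second one otherwise. -/
def interleave {α : Type} (f : ℕ → Bool) : ℕ → List α → List α → List α
  | _, [], ys => ys
  | _, b :: bs, [] => b :: bs
  | i, b :: bs, y :: ys =>
      if f i then b :: interleave f (i + 1) bs (y :: ys)
      else y :: interleave f (i + 1) (b :: bs) ys
  termination_by i bs ys => bs.length + ys.length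

/-- The indicator function of a finite set of positions. -/
def finsetIndicator {N : ℕ} (S : Finset (Fin N)) : ℕ → Bool :=
  fun i => if h : i < N then decide ((⟨i, h⟩ : Fin N) ∈ S) else false

/-- The entries of `l` are homogeneous of the indicated degrees. -/
def ListHomog (B : CDGA k) : List B.carrier → List ℕ → Prop :=
  List.Forall₂ (fun b q => b ∈ B.grading q)

/-- `ε_i = deg α + deg ω₁ + ⋯ + deg ω_i − i` (with `p = deg α` and `qs` the degrees of the
`ω`'s). -/
def eps (p : ℕ) (qs : List ℕ) (i : ℕ) : ℤ :=
  (p : ℤ) + ((qs.take i).sum : ℤ) - (i : ℤ)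

/-- `η = |c||x| + |x|(Σ|bᵢ| − k) + |c|(Σ|yⱼ| − l)` where `p2 = |x|`, `r1 = |c|`, `qs` the
degrees of the `b`'s and `rs` those of the `y`'s. -/
def etaSign (p2 r1 : ℕ) (qs rs : List ℕ) : ℤ :=
  (r1 : ℤ) * (p2 : ℤ) + (p2 : ℤ) * ((qs.sum : ℤ) - (qs.length : ℤ))
    + (r1 : ℤ) * ((rs.sum : ℤ) - (rs.length : ℤ))

/-- `n_σ = Σ (|bᵢ|−1)(|yⱼ|−1)` over the pairs `(i,j)` such that `bᵢ` is moved past `yⱼ` in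
the shuffle determined by the set `S` of positions of the `b`'s. -/
def shuffleSign (qs rs : List ℕ) {N : ℕ} (S : Finset (Fin N)) : ℤ :=
  ∑ s ∈ S, ∑ t ∈ Sᶜ,
    if t < s then
      (((qs.getD ((S.filter (· < s)).card) 0 : ℕ) : ℤ) - 1) *
        (((rs.getD ((Sᶜ.filter (· < t)).card) 0 : ℕ) : ℤ) - 1)
    else 0
/-- The (Eilenberg–Moore / Chen) bar complex `B(A, B, C)` of kCDGA morphisms
`fA : B → A` and `fC : B → C`, presented as a `k`-module `Bar` together with the
multilinear "pure tensor" map `ι a [ω₁, …, ω_k] c = (a, ω₁, …, ω_k, c)`, the total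
(`ℤ`-valued) grading, the bar grading, the internal differential `dBar`, the bar
differential `δBar`, the shuffle product `mul`, and the insertion operators
`ins f i = S_{i+1}(f)` — each determined by its defining formula on homogeneous
pure tensors. -/
structure BarData (A B C : CDGA k) (fA : CDGAHom B A) (fC : CDGAHom B C) : Type 1 where
  Bar : Type
  [acg : AddCommGroup Bar]
  [mod : Module k Bar]
  ι : A.carrier → List B.carrier → C.carrier → Bar
  ι_add_left : ∀ a a' l c, ι (a + a') l c = ι a l c + ι a' l c
  ι_smul_left : ∀ (r : k) a l c, ι (r • a) l c = r • ι a l c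
  ι_add_right : ∀ a l c c', ι a l (c + c') = ι a l c + ι a l c'
  ι_smul_right : ∀ (r : k) a l c, ι a l (r • c) = r • ι a l c
  ι_add_mid : ∀ a l₁ b b' l₂ c,
      ι a (l₁ ++ (b + b') :: l₂) c = ι a (l₁ ++ b :: l₂) c + ι a (l₁ ++ b' :: l₂) c
  ι_smul_mid : ∀ (r : k) a l₁ b l₂ c,
      ι a (l₁ ++ (r • b) :: l₂) c = r • ι a (l₁ ++ b :: l₂) c
  span_ι : Submodule.span k {x : Bar | ∃ a l c, x = ι a l c} = ⊤
  grading : ℤ → Submodule k Bar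
  [decomp : DirectSum.Decomposition grading]
  ι_mem : ∀ {p : ℕ} {a : A.carrier} {l : List B.carrier} {qs : List ℕ} {r : ℕ} {c : C.carrier},
      a ∈ A.grading p → ListHomog B l qs → c ∈ C.grading r →
      ι a l c ∈ grading ((p : ℤ) + (qs.sum : ℤ) - (l.length : ℤ) + (r : ℤ))
  barGrading : ℕ → Submodule k Bar
  [barDecomp : DirectSum.Decomposition barGrading]
  ι_bar_mem : ∀ a l c, ι a l c ∈ barGrading l.length
  dBar : Bar →ₗ[k] Bar
  dBar_eq : ∀ {p : ℕ} {a : A.carrier} {l : List B.carrier} {qs : List ℕ} {r : ℕ}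
      {c : C.carrier}, a ∈ A.grading p → ListHomog B l qs → c ∈ C.grading r →
      dBar (ι a l c) =
        ι (A.d a) l c
        + ∑ i ∈ Finset.range l.length,
            ((-1 : k) ^ (eps p qs i + 1)) • ι a (modifyAt (fun b => B.d b) l i) c
        + ((-1 : k) ^ (eps p qs l.length)) • ι a l (C.d c)
  δBar : Bar →ₗ[k] Bar
  δBar_nil : ∀ a c, δBar (ι a [] c) = 0
  δBar_eq : ∀ {p : ℕ} {a : A.carrier} {b : B.carrier} {q : ℕ} {t : List B.carrier}
      {qt : List ℕ} {r : ℕ} {c : C.carrier},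
      a ∈ A.grading p → b ∈ B.grading q → ListHomog B t qt → c ∈ C.grading r →
      - δBar (ι a (b :: t) c) =
        ((-1 : k) ^ (p : ℤ)) • ι (a * fA.toHom b) t c
        + ∑ i ∈ Finset.Icc 1 t.length,
            ((-1 : k) ^ (eps p (q :: qt) i)) • ι a (mergeAt (· * ·) (b :: t) (i - 1)) c
        + ((-1 : k) ^ (eps p (q :: qt) t.length + 1)) •
            ι a ((b :: t).dropLast) (fC.toHom ((b :: t).getLast (List.cons_ne_nil b t)) * c)
  mul : Bar →ₗ[k] Bar →ₗ[k] Bar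
  mul_eq : ∀ {p₁ : ℕ} {a : A.carrier} {bs : List B.carrier} {qs : List ℕ} {r₁ : ℕ}
      {c : C.carrier} {p₂ : ℕ} {x : A.carrier} {ys : List B.carrier} {rs : List ℕ}
      {r₂ : ℕ} {z : C.carrier},
      a ∈ A.grading p₁ → ListHomog B bs qs → c ∈ C.grading r₁ →
      x ∈ A.grading p₂ → ListHomog B ys rs → z ∈ C.grading r₂ →
      mul (ι a bs c) (ι x ys z) =
        ∑ S ∈ Finset.univ.filter
            (fun S : Finset (Fin (bs.length + ys.length)) => S.card = bs.length),
          ((-1 : k) ^ (etaSign p₂ r₁ qs rs + shuffleSign qs rs S)) •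
            ι (a * x) (interleave (finsetIndicator S) 0 bs ys) (c * z)
  ins : B.carrier → ℕ → Bar →ₗ[k] Bar
  ins_eq : ∀ {f : B.carrier}, f ∈ B.grading 0 → ∀ (i : ℕ) a l c, i ≤ l.length →
      ins f i (ι a l c) = ι a (insertAt f i l) c
  ins_zero : ∀ {f : B.carrier}, f ∈ B.grading 0 → ∀ (i : ℕ) a l c, l.length < i →
      ins f i (ι a l c) = 0

attribute [instance] BarData.acg BarData.mod BarData.decomp BarData.barDecomp

namespace BarData

variable {A B C : CDGA k} {fA : CDGAHom B A} {fC : CDGAHom B C}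

/-- The total differential `D = d + δ`. -/
def D (X : BarData A B C fA fC) : X.Bar →ₗ[k] X.Bar := X.dBar + X.δBar

/-- The subspace `W` of the bar complex, generated by the images of the insertion
operators `S_i(f)`, `f ∈ B⁰`, and of the operators `D S_i(f) − S_i(f) D`. -/
def W (X : BarData A B C fA fC) : Submodule k X.Bar :=
  Submodule.span k
    ({x : X.Bar | ∃ f ∈ B.grading 0, ∃ (i : ℕ) (y : X.Bar), x = X.ins f i y} ∪
     {x : X.Bar | ∃ f ∈ B.grading 0, ∃ (i : ℕ) (y : X.Bar),
        x = X.D (X.ins f i y) - X.ins f i (X.D y)})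

end BarData
/-! Differential graded algebra data (used for the normalized bar complex `B̄ = B/W`),
chain-level quasi-isomorphisms, and cohomology. -/

/-- A chain map `φ : (V, D) → (V', D')` which is a quasi-isomorphism (induces an
isomorphism on cohomology). -/
def IsChainQuasiIso {V V' : Type} [AddCommGroup V] [Module k V] [AddCommGroup V']
    [Module k V'] (D : V →ₗ[k] V) (D' : V' →ₗ[k] V') (φ : V →ₗ[k] V') : Prop :=
  (∀ x, φ (D x) = D' (φ x)) ∧
  (∀ y, D' y = 0 → ∃ x, D x = 0 ∧ ∃ z, φ x - y = D' z) ∧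
  (∀ x, D x = 0 → (∃ z, φ x = D' z) → ∃ w, x = D w)

/-- A (not necessarily graded) differential algebra over `k`: the structure carried by
Chen's normalized bar complex. -/
structure DGA (k : Type) [Field k] : Type 1 where
  V : Type
  [acg : AddCommGroup V]
  [mod : Module k V]
  D : V →ₗ[k] V
  mul : V →ₗ[k] V →ₗ[k] V

attribute [instance] DGA.acg DGA.mod

/-- A morphism of differential algebras. -/
def IsDGAHom (X Y : DGA k) (φ : X.V →ₗ[k] Y.V) : Prop :=
  (∀ x, φ (X.D x) = Y.D (φ x)) ∧ ∀ x y, φ (X.mul x y) = Y.mul (φ x) (φ y)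

/-- There is a quasi-isomorphism `X → Y` of differential algebras. -/
def DGAQuasiIsoRel (X Y : DGA k) : Prop :=
  ∃ φ : X.V →ₗ[k] Y.V, IsDGAHom X Y φ ∧ IsChainQuasiIso X.D Y.D φ

/-- `X` and `Y` are connected by a chain of quasi-isomorphisms of differential algebras. -/
def DGAConnected : DGA k → DGA k → Prop :=
  Relation.ReflTransGen (fun X Y => DGAQuasiIsoRel X Y ∨ DGAQuasiIsoRel Y X)

/-- `X` is formal: connected by a chain of quasi-isomorphisms to a differential algebra
with zero differential (its cohomology). -/
def DGAFormal (X : DGA k) : Prop :=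
  ∃ Z : DGA k, Z.D = 0 ∧ DGAConnected X Z

/-- The cohomology `ker D / im D` of a module with differential. -/
abbrev cohomOf {V : Type} [AddCommGroup V] [Module k V] (D : V →ₗ[k] V) : Type :=
  LinearMap.ker D ⧸ (LinearMap.range D).comap (LinearMap.ker D).subtype

/-- The class of a cocycle in cohomology. -/
abbrev cohomMk {V : Type} [AddCommGroup V] [Module k V] (D : V →ₗ[k] V) (x : V)
    (hx : D x = 0) : cohomOf D :=
  Submodule.Quotient.mk ⟨x, by simpa [LinearMap.mem_ker] using hx⟩

/-! ### Signs -/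

/-- The sign `(-1)^x` for a parity `x`. -/
def paritySign (k : Type) [Field k] (x : ZMod 2) : k := if x = 0 then 1 else -1

@[simp] theorem paritySign_zero : paritySign k 0 = 1 := by simp [paritySign]

@[simp] theorem paritySign_one : paritySign k 1 = -1 := by simp [paritySign]

theorem ZMod.two_cases (x : ZMod 2) : x = 0 ∨ x = 1 := by
  revert x; decide

@[simp] theorem ZMod.two_one_add_one : (1 + 1 : ZMod 2) = 0 := by decide

theorem paritySign_add (x y : ZMod 2) :
    paritySign k (x + y) = paritySign k x * paritySign k y := by
  rcases ZMod.two_cases x with rfl | rfl <;> rcases ZMod.two_cases y with rfl | rfl <;> simp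

theorem neg_one_zpow_eq_paritySign (n : ℤ) : (-1 : k) ^ n = paritySign k (n : ZMod 2) := by
  rcases Int.even_or_odd n with h | h
  · rw [h.neg_one_zpow, (ZMod.intCast_zmod_eq_zero_iff_dvd n 2).2 h.two_dvd, paritySign_zero]
  · rw [h.neg_one_zpow, (ZMod.intCast_eq_one_iff_odd).2 h, paritySign_one]

theorem neg_one_pow_eq_paritySign (n : ℕ) : (-1 : k) ^ n = paritySign k (n : ZMod 2) := by
  simpa using neg_one_zpow_eq_paritySign (k := k) n

/-! ### Homogeneous elements -/

/-- A homogeneous element of a kCDGA together with its degree. -/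
@[ext] structure CDGA.Homog (A : CDGA k) where
  deg : ℕ
  val : A.carrier
  mem : val ∈ A.grading deg

namespace CDGA.Homog

variable {A B : CDGA k}

/-- The parity of the degree. -/
def par (a : A.Homog) : ZMod 2 := a.deg

instance : Mul A.Homog where
  mul a b := ⟨a.deg + b.deg, a.val * b.val, SetLike.mul_mem_graded a.mem b.mem⟩

@[simp] theorem mul_val (a b : A.Homog) : (a * b).val = a.val * b.val := rfl
@[simp] theorem mul_deg (a b : A.Homog) : (a * b).deg = a.deg + b.deg := rfl
@[simp] theorem mul_par (a b : A.Homog) : (a * b).par = a.par + b.par := by simp [par]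

protected theorem mul_assoc (a b c : A.Homog) : a * b * c = a * (b * c) := by
  ext <;> simp [add_assoc, mul_assoc]

/-- The differential of a homogeneous element. -/
def d (a : A.Homog) : A.Homog := ⟨a.deg + 1, A.d a.val, A.d_mem a.mem⟩

@[simp] theorem d_val (a : A.Homog) : a.d.val = A.d a.val := rfl
@[simp] theorem d_deg (a : A.Homog) : a.d.deg = a.deg + 1 := rfl
@[simp] theorem d_par (a : A.Homog) : a.d.par = a.par + 1 := by simp [par]

/-- The image of a homogeneous element under a morphism. -/
def map (f : CDGAHom A B) (a : A.Homog) : B.Homog := ⟨a.deg, f.toHom a.val, f.map_mem a.mem⟩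

@[simp] theorem map_val (f : CDGAHom A B) (a : A.Homog) : (a.map f).val = f.toHom a.val := rfl
@[simp] theorem map_deg (f : CDGAHom A B) (a : A.Homog) : (a.map f).deg = a.deg := rfl
@[simp] theorem map_par (f : CDGAHom A B) (a : A.Homog) : (a.map f).par = a.par := rfl

@[simp] theorem map_mul (f : CDGAHom A B) (a b : A.Homog) :
    (a * b).map f = a.map f * b.map f := by
  ext <;> simp

theorem mul_comm_val (a b : A.Homog) :
    a.val * b.val = paritySign k (a.par * b.par) • (b.val * a.val) := by
  rw [A.gcomm a.mem b.mem, neg_one_pow_eq_paritySign, Nat.cast_mul]; rfl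

theorem d_mul_val (a : A.Homog) (y : A.carrier) :
    A.d (a.val * y) = A.d a.val * y + paritySign k a.par • (a.val * A.d y) := by
  rw [A.leibniz a.val y a.mem, neg_one_pow_eq_paritySign]; rfl

end CDGA.Homog

/-! ### Tails of the bar complex

A tail `(ω₁, …, ω_k, c)` is a list of homogeneous elements of `B` followed by a homogeneous
element of `C`.  All structure of the bar complex is first described on the free module on
tails. -/

/-- The tails of the pure tensors of the bar complex. -/
inductive BarTail (B C : CDGA k) : Type
  | nil (c : C.Homog) : BarTail B C
  | cons (b : B.Homog) (t : BarTail B C) : BarTail B C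

/-- Formal linear combinations of tails. -/
abbrev TailModule (B C : CDGA k) : Type := BarTail B C →₀ k

namespace BarTail

variable {B C : CDGA k}

/-- The parity of the total degree of a tail. -/
def par : BarTail B C → ZMod 2
  | nil c => c.par
  | cons b t => b.par + 1 + t.par

/-- The basis element given by a tail. -/
noncomputable def gen (t : BarTail B C) : TailModule B C := Finsupp.single t 1

/-- The linear extension of a function on tails. -/
noncomputable def lift {M : Type} [AddCommMonoid M] [Module k M] (f : BarTail B C → M) :
    TailModule B C →ₗ[k] M := Finsupp.linearCombination k f

@[simp] theorem lift_gen {M : Type} [AddCommMonoid M] [Module k M] (f : BarTail B C → M)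
    (t : BarTail B C) : lift f t.gen = f t := by simp [lift, gen]

theorem hom_ext {M : Type} [AddCommMonoid M] [Module k M] {f g : TailModule B C →ₗ[k] M}
    (h : ∀ t : BarTail B C, f t.gen = g t.gen) : f = g :=
  Finsupp.lhom_ext' fun t => LinearMap.ext_ring (h t)

theorem hom_ext₂ {M : Type} [AddCommMonoid M] [Module k M]
    {f g : TailModule B C →ₗ[k] TailModule B C →ₗ[k] M}
    (h : ∀ t s : BarTail B C, f t.gen s.gen = g t.gen s.gen) : f = g :=
  hom_ext fun t => hom_ext fun s => h t s

/-- Prepending a letter. -/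
noncomputable def consL (b : B.Homog) : TailModule B C →ₗ[k] TailModule B C :=
  lift fun t => (cons b t).gen

@[simp] theorem consL_gen (b : B.Homog) (t : BarTail B C) :
    consL b t.gen = (cons b t).gen := lift_gen _ _

/-- The sign operator `t ↦ (-1)^{e |t|} t`. -/
noncomputable def signL (e : ZMod 2) : TailModule B C →ₗ[k] TailModule B C :=
  lift fun t => paritySign k (e * t.par) • t.gen

theorem signL_gen (e : ZMod 2) (t : BarTail B C) :
    signL e t.gen = paritySign k (e * t.par) • t.gen := lift_gen _ _

theorem signL_consL (e : ZMod 2) (b : B.Homog) (X : TailModule B C) :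
    signL e (consL b X) = paritySign k (e * (b.par + 1)) • consL b (signL e X) := by
  have : signL e ∘ₗ consL b =
      paritySign k (e * (b.par + 1)) • (consL (C := C) b ∘ₗ signL e) := by
    refine hom_ext fun t => ?_
    simp [signL_gen, par, smul_smul, ← paritySign_add, mul_add]
  exact LinearMap.congr_fun this X

theorem signL_signL (e e' : ZMod 2) (X : TailModule B C) :
    signL e (signL e' X) = signL (e + e') X := by
  have : signL e ∘ₗ signL e' = signL (B := B) (C := C) (e + e') := by
    refine hom_ext fun t => ?_
    simp [signL_gen, smul_smul, ← paritySign_add]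
    congr 2; ring
  exact LinearMap.congr_fun this X

@[simp] theorem signL_zero (X : TailModule B C) : signL 0 X = X := by
  have : signL (B := B) (C := C) 0 = LinearMap.id := hom_ext fun t => by simp [signL_gen]
  rw [this]; rfl

/-- The shuffle product of two tails. -/
noncomputable def shuffle : BarTail B C → BarTail B C → TailModule B C
  | nil c, nil z => (nil (c * z)).gen
  | nil c, cons y s => paritySign k ((y.par + 1) * c.par) • consL y (shuffle (nil c) s)
  | cons b t, nil z => consL b (shuffle t (nil z))
  | cons b t, cons y s => consL b (shuffle t (cons y s)) +
      paritySign k ((y.par + 1) * (b.par + 1 + t.par)) • consL y (shuffle (cons b t) s)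

/-- The shuffle product on linear combinations of tails. -/
noncomputable def mulL : TailModule B C →ₗ[k] TailModule B C →ₗ[k] TailModule B C :=
  lift fun t => lift fun s => shuffle t s

theorem mulL_gen (t s : BarTail B C) : mulL t.gen s.gen = shuffle t s := by
  simp [mulL]

theorem mulL_nil_nil (c z : C.Homog) :
    mulL (nil c : BarTail B C).gen (nil z).gen = (nil (c * z)).gen := by
  simp [mulL_gen, shuffle]

theorem mulL_nil_consL (c : C.Homog) (y : B.Homog) (Y : TailModule B C) :
    mulL (nil c).gen (consL y Y) =
      paritySign k ((y.par + 1) * c.par) • consL y (mulL (nil c).gen Y) := by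
  have : mulL (nil c).gen ∘ₗ consL y =
      paritySign k ((y.par + 1) * c.par) • (consL y ∘ₗ mulL (C := C) (nil c).gen) :=
    hom_ext fun t => by simp [mulL_gen, shuffle]
  exact LinearMap.congr_fun this Y

theorem mulL_consL_nil (b : B.Homog) (X : TailModule B C) (z : C.Homog) :
    mulL (consL b X) (nil z).gen = consL b (mulL X (nil z).gen) := by
  have : mulL.flip (nil z).gen ∘ₗ consL b = consL b ∘ₗ mulL.flip (nil z).gen :=
    hom_ext fun t => by simp [mulL_gen, shuffle]
  exact LinearMap.congr_fun this X

/-- The part of the shuffle product in which the first letter comes from the first factor, as an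
operator on the second factor. -/
noncomputable def leftGen : BarTail B C → TailModule B C →ₗ[k] TailModule B C
  | nil _ => 0
  | cons b t => consL b ∘ₗ mulL t.gen

/-- The part of the shuffle product in which the first letter comes from the first factor. -/
noncomputable def leftL : TailModule B C →ₗ[k] TailModule B C →ₗ[k] TailModule B C :=
  lift fun t : BarTail B C => leftGen t

@[simp] theorem leftL_nil (c : C.Homog) (Y : TailModule B C) : leftL (nil c).gen Y = 0 := by
  simp [leftL, leftGen]

theorem leftL_consL (b : B.Homog) (X Y : TailModule B C) :
    leftL (consL b X) Y = consL b (mulL X Y) := by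
  have : leftL ∘ₗ consL b = (mulL (C := C)).compr₂ (consL b) := by
    refine hom_ext fun t => ?_
    refine LinearMap.ext fun Y => ?_
    simp [leftL, leftGen]
  exact LinearMap.congr_fun (LinearMap.congr_fun this X) Y

theorem mulL_consL (y : B.Homog) (X Y : TailModule B C) :
    mulL X (consL y Y) =
      leftL X (consL y Y) + consL y (mulL (signL (y.par + 1) X) Y) := by
  have : (mulL (B := B) (C := C)).compl₂ (consL y) =
      leftL.compl₂ (consL y) + (mulL ∘ₗ signL (y.par + 1)).compr₂ (consL y) := by
    refine hom_ext₂ fun t s => ?_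
    cases t with
    | nil c => simp [mulL_gen, shuffle, signL_gen, par]
    | cons b t =>
      simp only [LinearMap.compl₂_apply, LinearMap.add_apply, LinearMap.compr₂_apply,
        LinearMap.comp_apply, consL_gen, signL_gen]
      rw [← consL_gen b t, leftL_consL]
      simp [mulL_gen, shuffle, par]
  exact LinearMap.congr_fun (LinearMap.congr_fun this X) Y

theorem mulL_consL_consL (b y : B.Homog) (X Y : TailModule B C) :
    mulL (consL b X) (consL y Y) = consL b (mulL X (consL y Y)) +
      paritySign k ((y.par + 1) * (b.par + 1)) •
        consL y (mulL (consL b (signL (y.par + 1) X)) Y) := by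
  rw [mulL_consL, leftL_consL, signL_consL]
  simp

theorem signL_shuffle (e : ZMod 2) (t s : BarTail B C) :
    signL e (shuffle t s) = paritySign k (e * (t.par + s.par)) • shuffle t s := by
  induction t, s using shuffle.induct with
  | case1 c z => simp [shuffle, signL_gen, par]
  | case2 c y s ih =>
    simp only [shuffle, map_smul, signL_consL, ih, smul_smul, ← paritySign_add, par]
    congr 2; ring
  | case3 b t z ih =>
    simp only [shuffle, map_smul, signL_consL, ih, smul_smul, ← paritySign_add, par]
    congr 2; ring
  | case4 b t y s ih₁ ih₂ =>
    simp only [shuffle, map_add, map_smul, signL_consL, ih₁, ih₂, smul_smul, smul_add,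
      ← paritySign_add, par]
    congr 3 <;> ring

theorem signL_mulL (e : ZMod 2) (X Y : TailModule B C) :
    signL e (mulL X Y) = mulL (signL e X) (signL e Y) := by
  have : mulL.compr₂ (signL e) = (mulL (B := B) (C := C)).compl₁₂ (signL e) (signL e) := by
    refine hom_ext₂ fun t s => ?_
    simp only [LinearMap.compr₂_apply, LinearMap.compl₁₂_apply, mulL_gen, signL_shuffle, signL_gen,
      map_smul, LinearMap.smul_apply, smul_smul, ← paritySign_add]
    congr 2; ring
  exact LinearMap.congr_fun (LinearMap.congr_fun this X) Y

theorem leftL_leftL {t : BarTail B C} (h : ∀ (b : B.Homog) (t' : BarTail B C), t = cons b t' →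
      ∀ Y Z, mulL (mulL t'.gen Y) Z = mulL t'.gen (mulL Y Z)) (Y Z : TailModule B C) :
    leftL (leftL t.gen Y) Z = leftL t.gen (mulL Y Z) := by
  cases t with
  | nil c => simp
  | cons b t' => rw [← consL_gen, leftL_consL, leftL_consL, leftL_consL, h b t' rfl]

theorem mulL_leftL_nil (X : TailModule B C) (Y : TailModule B C) (z : C.Homog) :
    mulL (leftL X Y) (nil z).gen = leftL (leftL X Y) (nil z).gen := by
  have : mulL.flip (nil z).gen ∘ₗ leftL.flip Y = leftL.flip (nil z).gen ∘ₗ leftL.flip Y := by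
    refine hom_ext fun t => ?_
    cases t with
    | nil c => simp
    | cons b t =>
      simp only [LinearMap.comp_apply, LinearMap.flip_apply]
      rw [← consL_gen, leftL_consL, leftL_consL, mulL_consL_nil]
  exact LinearMap.congr_fun this X

theorem mulL_assoc_gen (t s u : BarTail B C) :
    mulL (mulL t.gen s.gen) u.gen = mulL t.gen (mulL s.gen u.gen) := by
  have extend : ∀ {t : BarTail B C}, (∀ s u : BarTail B C,
      mulL (mulL t.gen s.gen) u.gen = mulL t.gen (mulL s.gen u.gen)) →
      ∀ Y Z, mulL (mulL t.gen Y) Z = mulL t.gen (mulL Y Z) := fun {t} h Y Z => by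
    have : mulL ∘ₗ mulL t.gen = (mulL (B := B) (C := C)).compr₂ (mulL t.gen) :=
      hom_ext₂ fun s u => h s u
    exact LinearMap.congr_fun (LinearMap.congr_fun this Y) Z
  have step : ∀ {t : BarTail B C}, (∀ (b : B.Homog) (t' : BarTail B C), t = cons b t' →
      ∀ Y Z, mulL (mulL t'.gen Y) Z = mulL t'.gen (mulL Y Z)) →
      ∀ s u : BarTail B C, mulL (mulL t.gen s.gen) u.gen = mulL t.gen (mulL s.gen u.gen) := by
    intro t h s
    induction s with
    | nil y =>
      intro u
      induction u with
      | nil z =>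
        cases t with
        | nil c => simp [mulL_nil_nil, CDGA.Homog.mul_assoc]
        | cons b t' =>
          rw [← consL_gen b, mulL_consL_nil, mulL_consL_nil, h b t' rfl, mulL_nil_nil,
            mulL_consL_nil]
      | cons w u ih =>
        have hl : leftL (mulL t.gen (nil y).gen) (consL w u.gen) =
            leftL t.gen (mulL (nil y).gen (consL w u.gen)) := by
          cases t with
          | nil c => simp [mulL_nil_nil]
          | cons b t' =>
            rw [← consL_gen b, mulL_consL_nil, leftL_consL, leftL_consL, h b t' rfl]
        rw [← consL_gen w, mulL_consL, hl, mulL_consL w (nil y).gen, leftL_nil, zero_add,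
          mulL_consL w t.gen, signL_mulL]
        simp only [signL_gen, map_smul, LinearMap.smul_apply, ih]
    | cons y s ihs =>
      have ihs' : ∀ Z, mulL (mulL t.gen s.gen) Z = mulL t.gen (mulL s.gen Z) := fun Z =>
        LinearMap.congr_fun (hom_ext (f := mulL (mulL t.gen s.gen))
          (g := mulL t.gen ∘ₗ mulL s.gen) ihs) Z
      intro u
      induction u with
      | nil z =>
        rw [← consL_gen y, mulL_consL_nil, mulL_consL, mulL_consL, map_add, LinearMap.add_apply,
          mulL_leftL_nil, leftL_leftL h, mulL_consL_nil, mulL_consL_nil]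
        simp only [signL_gen, map_smul, LinearMap.smul_apply, ihs]
      | cons w u ihu =>
        have hl : leftL (mulL t.gen (consL y s.gen)) (consL w u.gen) =
            mulL t.gen (leftL (consL y s.gen) (consL w u.gen)) +
            leftL t.gen (consL w (mulL (signL (w.par + 1) (consL y s.gen)) u.gen)) := by
          rw [leftL_consL, mulL_consL y t.gen, mulL_consL y t.gen, map_add, LinearMap.add_apply,
            leftL_leftL h, leftL_consL, mulL_consL w (consL y s.gen), leftL_consL, map_add]
          simp only [signL_gen, map_smul, LinearMap.smul_apply, ihs']
          abel
        rw [← consL_gen w, mulL_consL w (mulL _ _), ← consL_gen y, hl, consL_gen y,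
          mulL_consL w (cons y s).gen, map_add, mulL_consL w t.gen, signL_mulL, add_assoc]
        simp only [signL_gen, map_smul, LinearMap.smul_apply, ihu]
  induction t generalizing s u with
  | nil c => exact step (by simp) s u
  | cons b t iht =>
    refine step (fun b' t' h => ?_) s u
    obtain ⟨-, rfl⟩ := BarTail.cons.inj h
    exact extend iht

theorem mulL_assoc (X Y Z : TailModule B C) : mulL (mulL X Y) Z = mulL X (mulL Y Z) := by
  have h : ∀ (t : BarTail B C) (Y Z : TailModule B C),
      mulL (mulL t.gen Y) Z = mulL t.gen (mulL Y Z) := fun t Y Z => by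
    have : mulL ∘ₗ mulL t.gen = (mulL (B := B) (C := C)).compr₂ (mulL t.gen) :=
      hom_ext₂ fun s u => mulL_assoc_gen t s u
    exact LinearMap.congr_fun (LinearMap.congr_fun this Y) Z
  have : mulL.flip Z ∘ₗ mulL.flip Y = mulL.flip (mulL Y Z) := hom_ext fun t => h t Y Z
  exact LinearMap.congr_fun this X

variable {A B C : CDGA k} {fA : CDGAHom B A} {fC : CDGAHom B C}

/-- Multiplying a homogeneous element of `B` into the first entry of a tail. -/
noncomputable def mergeGen (fC : CDGAHom B C) (b : B.Homog) : BarTail B C → TailModule B C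
  | nil c => paritySign k b.par • (nil (b.map fC * c)).gen
  | cons b' t => (cons (b * b') t).gen

/-- The linear extension of `mergeGen`. -/
noncomputable def mergeL (fC : CDGAHom B C) (b : B.Homog) : TailModule B C →ₗ[k] TailModule B C :=
  lift (mergeGen fC b)

theorem mergeL_nil (b : B.Homog) (c : C.Homog) :
    mergeL fC b (nil c).gen = paritySign k b.par • (nil (b.map fC * c)).gen := by
  simp [mergeL, mergeGen]

theorem mergeL_consL (b b' : B.Homog) (X : TailModule B C) :
    mergeL fC b (consL b' X) = consL (b * b') X := by
  have : mergeL fC b ∘ₗ consL b' = consL (b * b') :=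
    hom_ext fun t => by simp [mergeL, mergeGen]
  exact LinearMap.congr_fun this X

/-- The internal differential on tails. -/
noncomputable def dGen : BarTail B C → TailModule B C
  | nil c => (nil c.d).gen
  | cons b t => -(cons b.d t).gen + paritySign k (b.par + 1) • consL b (dGen t)

/-- The bar differential on tails. -/
noncomputable def deltaGen (fC : CDGAHom B C) : BarTail B C → TailModule B C
  | nil _ => 0
  | cons b t => paritySign k b.par • mergeGen fC b t +
      paritySign k (b.par + 1) • consL b (deltaGen fC t)

/-- The total differential on tails. -/
noncomputable def diffL (fC : CDGAHom B C) : TailModule B C →ₗ[k] TailModule B C :=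
  lift fun t => dGen t + deltaGen fC t

theorem diffL_nil (c : C.Homog) : diffL fC (nil c : BarTail B C).gen = (nil c.d).gen := by
  simp [diffL, dGen, deltaGen]

theorem diffL_consL (b : B.Homog) (X : TailModule B C) :
    diffL fC (consL b X) = -consL b.d X + paritySign k b.par • mergeL fC b X +
      paritySign k (b.par + 1) • consL b (diffL fC X) := by
  have : diffL fC ∘ₗ consL b = -consL b.d + paritySign k b.par • mergeL fC b +
      paritySign k (b.par + 1) • (consL b ∘ₗ diffL fC) := by
    refine hom_ext fun t => ?_
    simp [diffL, dGen, deltaGen, mergeL]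
    abel
  exact LinearMap.congr_fun this X

theorem signL_mergeL (e : ZMod 2) (b : B.Homog) (X : TailModule B C) :
    signL e (mergeL fC b X) = paritySign k (e * b.par) • mergeL fC b (signL e X) := by
  have : signL e ∘ₗ mergeL fC b = paritySign k (e * b.par) • (mergeL fC b ∘ₗ signL e) := by
    refine hom_ext fun t => ?_
    cases t with
    | nil c =>
      simp only [LinearMap.comp_apply, LinearMap.smul_apply, signL_gen, map_smul, mergeL_nil,
        smul_smul, ← paritySign_add, par, CDGA.Homog.mul_par, CDGA.Homog.map_par]
      congr 2; ring
    | cons b' t =>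
      simp only [LinearMap.comp_apply, LinearMap.smul_apply, ← consL_gen, signL_consL, map_smul,
        mergeL_consL, CDGA.Homog.mul_par, smul_smul, ← paritySign_add]
      congr 2; ring
  exact LinearMap.congr_fun this X

theorem signL_diffL (e : ZMod 2) (X : TailModule B C) :
    signL e (diffL fC X) = paritySign k e • diffL fC (signL e X) := by
  have : signL e ∘ₗ diffL fC = paritySign k e • (diffL fC ∘ₗ signL e) := by
    refine hom_ext fun t => ?_
    induction t with
    | nil c =>
      simp only [LinearMap.comp_apply, LinearMap.smul_apply, signL_gen, map_smul, diffL_nil,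
        smul_smul, ← paritySign_add, par, CDGA.Homog.d_par]
      congr 2; ring
    | cons b t ih =>
      simp only [LinearMap.comp_apply, LinearMap.smul_apply] at ih
      simp only [LinearMap.comp_apply, LinearMap.smul_apply, ← consL_gen, diffL_consL, map_smul,
        map_add, map_neg, signL_consL, signL_mergeL, ih, CDGA.Homog.d_par]
      rcases ZMod.two_cases e with rfl | rfl <;> rcases ZMod.two_cases b.par with h | h <;>
        simp [h]
  exact LinearMap.congr_fun this X

/-! ### Evaluation of tails in the bar complex -/

/-- The list of letters of a tail. -/
def word : BarTail B C → List B.carrier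
  | nil _ => []
  | cons b t => b.val :: word t

/-- The degrees of the letters of a tail. -/
def degs : BarTail B C → List ℕ
  | nil _ => []
  | cons b t => b.deg :: degs t

/-- The end of a tail. -/
def last : BarTail B C → C.Homog
  | nil c => c
  | cons _ t => last t

theorem listHomog (t : BarTail B C) : ListHomog B t.word t.degs := by
  induction t with
  | nil c => exact List.Forall₂.nil
  | cons b t ih => exact List.Forall₂.cons b.mem ih

@[simp] theorem length_degs (t : BarTail B C) : t.degs.length = t.word.length :=
  t.listHomog.length_eq.symm

end BarTail

namespace BarData

variable {A B C : CDGA k} {fA : CDGAHom B A} {fC : CDGAHom B C} (X : BarData A B C fA fC)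

open BarTail

/-- The element `(a, p, t)` of the bar complex, as a function of the prefix `p`. -/
noncomputable def evalL (a : A.carrier) : TailModule B C →ₗ[k] (List B.carrier → X.Bar) :=
  lift fun t p => X.ι a (p ++ t.word) t.last.val

/-- The operator of appending a letter to the prefix. -/
def shiftL (b : B.carrier) : (List B.carrier → X.Bar) →ₗ[k] (List B.carrier → X.Bar) :=
  LinearMap.funLeft k X.Bar fun p => p ++ [b]

theorem evalL_consL (a : A.carrier) (b : B.Homog) (Y : TailModule B C) :
    X.evalL a (consL b Y) = X.shiftL b.val (X.evalL a Y) := by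
  have : X.evalL a ∘ₗ consL b = X.shiftL b.val ∘ₗ X.evalL a := by
    refine hom_ext fun t => ?_
    ext p
    simp [evalL, shiftL, word, last, LinearMap.funLeft]
  exact LinearMap.congr_fun this Y

/-- Linearity in the letter of `shiftL`, applied to an evaluated tail. -/
noncomputable def letterL (a : A.carrier) (Y : TailModule B C) :
    B.carrier →ₗ[k] (List B.carrier → X.Bar) where
  toFun b := X.shiftL b (X.evalL a Y)
  map_add' b b' := by
    induction Y using Finsupp.induction_linear with
    | zero => simp
    | add Y Z hY hZ => simp only [map_add, hY, hZ]; abel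
    | single t r =>
      rw [← mul_one r, ← smul_eq_mul, ← Finsupp.smul_single]
      simp only [map_smul]
      rw [← smul_add]
      congr 1
      ext p
      simpa [evalL, shiftL, LinearMap.funLeft, BarTail.lift] using X.ι_add_mid a p b b' t.word _
  map_smul' r b := by
    induction Y using Finsupp.induction_linear with
    | zero => simp
    | add Y Z hY hZ => simp only [map_add, hY, hZ, smul_add]
    | single t s =>
      rw [← mul_one s, ← smul_eq_mul, ← Finsupp.smul_single]
      simp only [map_smul, RingHom.id_apply]
      rw [smul_comm]
      congr 1
      ext p
      simpa [evalL, shiftL, LinearMap.funLeft, BarTail.lift] using X.ι_smul_mid r a p b t.word _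

theorem evalL_consL_eq (a : A.carrier) (b : B.Homog) (Y : TailModule B C) :
    X.evalL a (consL b Y) = X.letterL a Y b.val := X.evalL_consL a b Y

end BarData

namespace BarTail

variable {A B C : CDGA k} {fA : CDGAHom B A} {fC : CDGAHom B C}

theorem mulL_mergeL_nil (b : B.Homog) (X : TailModule B C) (z : C.Homog) :
    mulL (mergeL fC b X) (nil z).gen = mergeL fC b (mulL X (nil z).gen) := by
  have : mulL.flip (nil z).gen ∘ₗ mergeL fC b = mergeL fC b ∘ₗ mulL.flip (nil z).gen := by
    refine hom_ext fun t => ?_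
    cases t with
    | nil c => simp [mergeL_nil, mulL_nil_nil, CDGA.Homog.mul_assoc]
    | cons b' t =>
      simp only [LinearMap.comp_apply, LinearMap.flip_apply, ← consL_gen, mergeL_consL,
        mulL_consL_nil]
  exact LinearMap.congr_fun this X

theorem mulL_mergeL_consL (b y : B.Homog) (X Y : TailModule B C) :
    mulL (mergeL fC b X) (consL y Y) = mergeL fC b (mulL X (consL y Y)) -
      consL (b * y) (mulL (signL (y.par + 1) X) Y) +
      paritySign k ((y.par + 1) * b.par) •
        consL y (mulL (mergeL fC b (signL (y.par + 1) X)) Y) := by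
  have : (mulL.flip (consL y Y)) ∘ₗ mergeL fC b = mergeL fC b ∘ₗ mulL.flip (consL y Y) -
      consL (b * y) ∘ₗ mulL.flip Y ∘ₗ signL (y.par + 1) +
      paritySign k ((y.par + 1) * b.par) •
        (consL y ∘ₗ mulL.flip Y ∘ₗ mergeL fC b ∘ₗ signL (y.par + 1)) := by
    refine hom_ext fun t => ?_
    cases t with
    | nil c =>
      simp only [LinearMap.comp_apply, LinearMap.flip_apply, LinearMap.add_apply,
        LinearMap.sub_apply, LinearMap.smul_apply, mergeL_nil, map_smul, mulL_nil_consL, signL_gen,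
        mergeL_consL, par, CDGA.Homog.mul_par, CDGA.Homog.map_par, smul_smul, ← paritySign_add,
        sub_self, zero_add]
      congr 2; ring
    | cons b' t =>
      simp only [LinearMap.comp_apply, LinearMap.flip_apply, LinearMap.add_apply,
        LinearMap.sub_apply, LinearMap.smul_apply, ← consL_gen, mergeL_consL, mulL_consL_consL,
        signL_consL, map_add, map_smul, signL_gen, CDGA.Homog.mul_par, smul_smul,
        ← paritySign_add]
      rw [add_sub_cancel_right]
      congr 3; ring
  exact LinearMap.congr_fun this X

theorem mulL_nil_mergeL_consL (c : C.Homog) (y y' : B.Homog) (Y : TailModule B C) :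
    mulL (nil c).gen (mergeL fC y (consL y' Y)) =
      paritySign k (c.par * y.par) • mergeL fC y (mulL (nil c).gen (consL y' Y)) := by
  simp only [mergeL_consL, mulL_nil_consL, map_smul, CDGA.Homog.mul_par, smul_smul,
    ← paritySign_add]
  congr 2; ring

theorem mulL_consL_mergeL (b y : B.Homog) (X Y : TailModule B C) :
    mulL (consL b X) (mergeL fC y Y) = consL b (mulL X (mergeL fC y Y)) +
      paritySign k (y.par * (b.par + 1)) •
        (mergeL fC y (mulL (consL b (signL y.par X)) Y) -
          consL (y * b) (mulL (signL y.par X) Y)) := by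
  have : mulL (consL b X) ∘ₗ mergeL fC y = consL b ∘ₗ mulL X ∘ₗ mergeL fC y +
      paritySign k (y.par * (b.par + 1)) •
        (mergeL fC y ∘ₗ mulL (consL b (signL y.par X)) -
          consL (y * b) ∘ₗ mulL (signL y.par X)) := by
    refine hom_ext fun t => ?_
    cases t with
    | nil z =>
      simp only [LinearMap.comp_apply, LinearMap.add_apply, LinearMap.sub_apply,
        LinearMap.smul_apply, mergeL_nil, map_smul, mulL_consL_nil, mergeL_consL, sub_self,
        smul_zero, add_zero]
    | cons y' t =>
      simp only [LinearMap.comp_apply, LinearMap.add_apply, LinearMap.sub_apply,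
        LinearMap.smul_apply, ← consL_gen, mergeL_consL, mulL_consL_consL, map_add, map_smul,
        signL_signL, add_sub_cancel_left, CDGA.Homog.mul_par, smul_smul, ← paritySign_add]
      have h₁ : y'.par + 1 + y.par = y.par + y'.par + 1 := by ring
      rw [h₁]
      congr 3; ring
  exact LinearMap.congr_fun this Y

end BarTail

namespace BarData

variable {A B C : CDGA k} {fA : CDGAHom B A} {fC : CDGAHom B C} (X : BarData A B C fA fC)

open BarTail

/-- Linearity in the end of a tail without letters. -/
noncomputable def endL (a : A.carrier) : C.carrier →ₗ[k] (List B.carrier → X.Bar) where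
  toFun c p := X.ι a p c
  map_add' c c' := funext fun p => X.ι_add_right a p c c'
  map_smul' r c := funext fun p => X.ι_smul_right r a p c

theorem evalL_nil (a : A.carrier) (c : C.Homog) :
    X.evalL a (nil c).gen = X.endL a c.val := by
  ext p
  simp [evalL, endL, word, last]

theorem evalL_consL_mul_comm (a : A.carrier) (b y : B.Homog) (Z : TailModule B C) :
    X.evalL a (consL (b * y) Z) =
      paritySign k (b.par * y.par) • X.evalL a (consL (y * b) Z) := by
  rw [evalL_consL_eq, evalL_consL_eq, ← map_smul]
  exact congrArg _ (CDGA.Homog.mul_comm_val b y)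

theorem evalL_nil_mul_comm (a : A.carrier) (c z : C.Homog) :
    X.evalL a (nil (c * z)).gen =
      paritySign k (c.par * z.par) • X.evalL a (nil (z * c)).gen := by
  rw [evalL_nil, evalL_nil, ← map_smul]
  exact congrArg _ (CDGA.Homog.mul_comm_val c z)

theorem evalL_consL_d_mul (a : A.carrier) (b y : B.Homog) (Z : TailModule B C) :
    X.evalL a (consL (b * y).d Z) = X.evalL a (consL (b.d * y) Z) +
      paritySign k b.par • X.evalL a (consL (b * y.d) Z) := by
  simp only [evalL_consL_eq, ← map_smul, ← map_add]
  exact congrArg _ (CDGA.Homog.d_mul_val b y.val)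

theorem evalL_nil_d_mul (a : A.carrier) (c z : C.Homog) :
    X.evalL a (nil (c * z).d).gen = X.evalL a (nil (c.d * z)).gen +
      paritySign k c.par • X.evalL a (nil (c * z.d)).gen := by
  simp only [evalL_nil, ← map_smul, ← map_add]
  exact congrArg _ (CDGA.Homog.d_mul_val c z.val)

theorem evalL_consL_d_d (a : A.carrier) (b : B.Homog) (Z : TailModule B C) :
    X.evalL a (consL b.d.d Z) = 0 := by
  rw [evalL_consL_eq, CDGA.Homog.d_val, CDGA.Homog.d_val, B.d_sq, map_zero]

theorem evalL_nil_d_d (a : A.carrier) (c : C.Homog) : X.evalL a (nil c.d.d).gen = 0 := by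
  rw [evalL_nil, CDGA.Homog.d_val, CDGA.Homog.d_val, C.d_sq, map_zero]

theorem evalL_diffL_mergeL (a : A.carrier) (b : B.Homog) (Y : TailModule B C) :
    X.evalL a (diffL fC (mergeL fC b Y)) =
      X.evalL a (paritySign k b.par • mergeL fC b (diffL fC Y) - mergeL fC b.d Y) := by
  have : X.evalL a ∘ₗ diffL fC ∘ₗ mergeL fC b =
      X.evalL a ∘ₗ (paritySign k b.par • (mergeL fC b ∘ₗ diffL fC) - mergeL fC b.d) := by
    refine hom_ext fun t => ?_
    cases t with
    | nil c =>
      have h : (b.map fC).d = b.d.map fC := by ext <;> simp [fC.map_d]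
      simp only [LinearMap.comp_apply, LinearMap.sub_apply, LinearMap.smul_apply, mergeL_nil,
        map_smul, diffL_nil, evalL_nil_d_mul, map_sub, h, CDGA.Homog.map_par, CDGA.Homog.d_par]
      rcases ZMod.two_cases b.par with h | h <;> simp [h] <;> abel
    | cons b' t =>
      have h : mergeL fC b (mergeL fC b' t.gen) = mergeL fC (b * b') t.gen := by
        cases t with
        | nil c =>
          simp only [mergeL_nil, map_smul, smul_smul, ← paritySign_add, CDGA.Homog.map_mul,
            CDGA.Homog.mul_par, CDGA.Homog.mul_assoc]
          congr 2; ring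
        | cons w t => simp only [← consL_gen, mergeL_consL, CDGA.Homog.mul_assoc]
      simp only [LinearMap.comp_apply, LinearMap.sub_apply, LinearMap.smul_apply, ← consL_gen,
        mergeL_consL, map_smul, diffL_consL, evalL_consL_d_mul, map_sub, map_add, map_neg, h,
        CDGA.Homog.mul_par]
      rcases ZMod.two_cases b.par with h | h <;> rcases ZMod.two_cases b'.par with h' | h' <;>
        simp [h, h'] <;> abel
  exact LinearMap.congr_fun this Y

theorem evalL_diffL_diffL (a : A.carrier) (Y : TailModule B C) :
    X.evalL a (diffL fC (diffL fC Y)) = 0 := by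
  have : X.evalL a ∘ₗ diffL fC ∘ₗ diffL fC = 0 := by
    refine hom_ext fun t => ?_
    induction t with
    | nil c => simp [diffL_nil, evalL_nil_d_d]
    | cons b t ih =>
      replace ih : X.evalL a (diffL fC (diffL fC t.gen)) = 0 := ih
      simp only [LinearMap.comp_apply, ← consL_gen, map_smul, diffL_consL, map_sub, map_add,
        map_neg, evalL_diffL_mergeL, evalL_consL_d_d, CDGA.Homog.d_par]
      rw [X.evalL_consL a b (diffL fC (diffL fC t.gen)), ih]
      rcases ZMod.two_cases b.par with h | h <;> simp [h] <;> abel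
  exact LinearMap.congr_fun this Y

theorem evalL_mulL_comm (a : A.carrier) (t s : BarTail B C) :
    X.evalL a (mulL t.gen s.gen) =
      paritySign k (t.par * s.par) • X.evalL a (mulL s.gen t.gen) := by
  simp only [mulL_gen]
  induction t, s using shuffle.induct with
  | case1 c z => simp [shuffle, par, ← evalL_nil_mul_comm]
  | case2 c y s ih =>
    simp only [shuffle, map_smul, evalL_consL, ih, smul_smul, ← paritySign_add, par]
    congr 2; ring
  | case3 b t z ih =>
    simp only [shuffle, map_smul, evalL_consL, ih, smul_smul, ← paritySign_add, par]
    congr 2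
    rcases ZMod.two_cases b.par with h | h <;> rcases ZMod.two_cases z.par with h' | h' <;>
      rcases ZMod.two_cases t.par with h₁ | h₁ <;> simp [h, h', h₁]
  | case4 b t y s ih₁ ih₂ =>
    simp only [shuffle, map_add, map_smul, evalL_consL, ih₁, ih₂, smul_smul, smul_add,
      ← paritySign_add, par]
    rcases ZMod.two_cases b.par with h | h <;> rcases ZMod.two_cases y.par with h' | h' <;>
    rcases ZMod.two_cases t.par with h₁ | h₁ <;> rcases ZMod.two_cases s.par with h₂ | h₂ <;>
      simp [h, h', h₁, h₂, add_comm]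

theorem evalL_diffL_mulL_gen (a : A.carrier) (t s : BarTail B C) :
    X.evalL a (diffL fC (mulL t.gen s.gen)) =
      X.evalL a (mulL (diffL fC t.gen) s.gen + mulL (signL 1 t.gen) (diffL fC s.gen)) := by
  induction t generalizing s with
  | nil c =>
    induction s with
    | nil z =>
      simp [mulL_nil_nil, diffL_nil, evalL_nil_d_mul, signL_gen, par]
    | cons y s ih =>
      have hm : X.evalL a (mulL (nil c).gen (mergeL fC y s.gen)) = paritySign k (c.par * y.par) •
          X.evalL a (mergeL fC y (mulL (nil c).gen s.gen)) := by
        cases s with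
        | nil z =>
          have h : (c * y.map fC * z).val =
              paritySign k (c.par * y.par) • (y.map fC * c * z).val := by
            rw [CDGA.Homog.mul_val, CDGA.Homog.mul_val, CDGA.Homog.mul_comm_val, smul_mul_assoc]
            rfl
          simp only [mergeL_nil, map_smul, mulL_nil_nil, ← CDGA.Homog.mul_assoc, evalL_nil, h]
          rw [smul_comm]
        | cons y' s => rw [← consL_gen, mulL_nil_mergeL_consL, map_smul]
      simp only [← consL_gen, mulL_nil_consL, diffL_nil, diffL_consL, map_add, map_smul, map_neg,
        hm, X.evalL_consL a _ (diffL fC (mulL _ _)), ih, signL_gen, LinearMap.smul_apply,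
        CDGA.Homog.d_par, par]
      simp only [evalL_consL]
      rcases ZMod.two_cases c.par with h | h <;> rcases ZMod.two_cases y.par with h' | h' <;>
      simp [h, h'] <;> abel
  | cons b t iht =>
    induction s with
    | nil z =>
      have := iht (nil z)
      simp only [← consL_gen, mulL_consL_nil, diffL_nil, diffL_consL, map_add, map_smul, map_neg,
        mulL_mergeL_nil, X.evalL_consL a _ (diffL fC (mulL _ _)), this, signL_gen, signL_consL,
        LinearMap.smul_apply, LinearMap.add_apply, LinearMap.neg_apply]
      simp only [evalL_consL]
      rcases ZMod.two_cases b.par with h | h <;> rcases ZMod.two_cases t.par with h' | h' <;>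
      simp [h, h'] <;> abel
    | cons y s ihs =>
      have ih := iht (cons y s)
      simp only [← consL_gen] at ih ihs
      simp only [← consL_gen, mulL_consL_consL, mulL_mergeL_consL, mulL_consL_mergeL, diffL_consL,
        map_sub, map_add, map_smul, map_neg, X.evalL_consL a _ (diffL fC (mulL _ _)), ih, ihs,
        signL_gen, signL_consL, LinearMap.smul_apply, LinearMap.add_apply, LinearMap.neg_apply,
        CDGA.Homog.d_par, X.evalL_consL_mul_comm a y b]
      simp only [evalL_consL, signL_diffL, signL_gen, map_smul, LinearMap.smul_apply]
      rcases ZMod.two_cases b.par with h | h <;> rcases ZMod.two_cases t.par with h' | h' <;>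
        rcases ZMod.two_cases y.par with h₁ | h₁ <;> simp [h, h', h₁] <;> abel

end BarData

/-! ### Combinatorics of shuffles -/

theorem Finset.sum_finset_fin_succ {M : Type} [AddCommMonoid M] {N : ℕ}
    (g : Finset (Fin (N + 1)) → M) :
    ∑ S, g S = ∑ S : Finset (Fin N), g (insert 0 (S.map (Fin.succEmb N))) +
      ∑ S : Finset (Fin N), g (S.map (Fin.succEmb N)) := by
  have himg : (Finset.univ.map (Fin.succEmb N)).powerset =
      Finset.univ.image fun S : Finset (Fin N) => S.map (Fin.succEmb N) := by
    ext T
    simp only [Finset.mem_powerset, Finset.mem_image, Finset.mem_univ, true_and]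
    rw [Finset.subset_map_iff]
    simp [eq_comm]
  have hinj : Function.Injective fun S : Finset (Fin N) => S.map (Fin.succEmb N) :=
    Finset.map_injective _
  have hsum : ∀ h : Finset (Fin (N + 1)) → M,
      ∑ T ∈ (Finset.univ.map (Fin.succEmb N)).powerset, h T =
        ∑ S : Finset (Fin N), h (S.map (Fin.succEmb N)) := fun h => by
    rw [himg, Finset.sum_image fun _ _ _ _ e => hinj e]
  rw [← Finset.powerset_univ, Fin.univ_succ, Finset.cons_eq_insert,
    Finset.sum_powerset_insert (by simp), add_comm]
  exact congrArg₂ _ (hsum fun T => g (insert 0 T)) (hsum g)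

theorem Finset.compl_map_succEmb {N : ℕ} (S : Finset (Fin N)) :
    (S.map (Fin.succEmb N))ᶜ = insert 0 (Sᶜ.map (Fin.succEmb N)) := by
  ext i
  refine Fin.cases ?_ (fun j => ?_) i <;> simp

theorem Finset.compl_insert_map_succEmb {N : ℕ} (S : Finset (Fin N)) :
    (insert 0 (S.map (Fin.succEmb N)))ᶜ = Sᶜ.map (Fin.succEmb N) := by
  ext i
  refine Fin.cases ?_ (fun j => ?_) i <;> simp

theorem Finset.card_insert_map_succEmb {N : ℕ} (S : Finset (Fin N)) :
    (insert 0 (S.map (Fin.succEmb N))).card = S.card + 1 := by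
  rw [Finset.card_insert_of_notMem (by simp), Finset.card_map]

theorem Finset.card_filter_lt_map_succEmb {N : ℕ} (S : Finset (Fin N)) (s : Fin N) :
    ((S.map (Fin.succEmb N)).filter (· < Fin.succEmb N s)).card = (S.filter (· < s)).card := by
  rw [← Finset.card_map (Fin.succEmb N)]
  congr 1
  ext i
  rw [Finset.mem_filter]
  refine Fin.cases ?_ (fun j => ?_) i <;> simp

theorem Finset.card_filter_lt_insert_map_succEmb {N : ℕ} (S : Finset (Fin N)) (s : Fin N) :
    ((insert 0 (S.map (Fin.succEmb N))).filter (· < Fin.succEmb N s)).card =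
      (S.filter (· < s)).card + 1 := by
  rw [← Finset.card_insert_map_succEmb]
  congr 1
  ext i
  rw [Finset.mem_filter]
  refine Fin.cases ?_ (fun j => ?_) i <;> simp

theorem Finset.sum_card_filter_lt {ι M : Type} [LinearOrder ι] [AddCommMonoid M] (S : Finset ι)
    (g : ℕ → M) : ∑ s ∈ S, g (S.filter (· < s)).card = ∑ i ∈ Finset.range S.card, g i := by
  induction S using Finset.induction_on_max with
  | empty => simp
  | insert a S ha ih =>
    have hna : a ∉ S := fun h => lt_irrefl _ (ha a h)
    rw [Finset.sum_insert hna, Finset.card_insert_of_notMem hna, Finset.sum_range_succ, ← ih,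
      add_comm]
    congr 1
    · refine Finset.sum_congr rfl fun s hs => ?_
      rw [Finset.filter_insert, if_neg (ha s hs).le.not_gt]
    · rw [Finset.filter_insert, if_neg (lt_irrefl a), Finset.filter_true_of_mem ha]

theorem Finset.sum_card_eq_zero_fin_succ {M : Type} [AddCommMonoid M] {N : ℕ}
    (g : Finset (Fin (N + 1)) → M) :
    ∑ S with S.card = 0, g S =
      ∑ S : Finset (Fin N) with S.card = 0, g (S.map (Fin.succEmb N)) := by
  rw [Finset.sum_filter, Finset.sum_finset_fin_succ, Finset.sum_filter]
  simp only [Finset.card_insert_map_succEmb, Finset.card_map]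
  simp

theorem Finset.sum_card_eq_succ_fin_succ {M : Type} [AddCommMonoid M] {N m : ℕ}
    (g : Finset (Fin (N + 1)) → M) :
    ∑ S with S.card = m + 1, g S =
      ∑ S : Finset (Fin N) with S.card = m, g (insert 0 (S.map (Fin.succEmb N))) +
        ∑ S : Finset (Fin N) with S.card = m + 1, g (S.map (Fin.succEmb N)) := by
  rw [Finset.sum_filter, Finset.sum_finset_fin_succ, Finset.sum_filter, Finset.sum_filter]
  simp only [Finset.card_insert_map_succEmb, Finset.card_map, add_left_inj]

theorem Finset.sum_card_eq_of_lt {M : Type} [AddCommMonoid M] {N m : ℕ} (h : N < m)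
    (g : Finset (Fin N) → M) : ∑ S with S.card = m, g S = 0 := by
  refine Finset.sum_eq_zero fun S hS => ?_
  have := S.card_le_univ
  rw [Fintype.card_fin, (Finset.mem_filter.1 hS).2] at this
  omega

theorem List.sum_range_getD_sub_one (qs : List ℕ) :
    ∑ i ∈ Finset.range qs.length, (((qs.getD i 0 : ℕ) : ℤ) - 1) = (qs.sum : ℤ) - qs.length := by
  induction qs with
  | nil => simp
  | cons q qs ih =>
    simp only [List.length_cons, Finset.sum_range_succ', List.getD_cons_succ, ih,
      List.getD_cons_zero, List.sum_cons]
    push_cast; ring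

theorem shuffleSign_insert (q : ℕ) (qs rs : List ℕ) {N : ℕ} (S : Finset (Fin N)) :
    shuffleSign (q :: qs) rs (insert 0 (S.map (Fin.succEmb N))) = shuffleSign qs rs S := by
  simp only [shuffleSign, Finset.compl_insert_map_succEmb]
  rw [Finset.sum_insert (by simp)]
  rw [Finset.sum_eq_zero (s := Sᶜ.map _) fun t _ => if_neg (Fin.not_lt_zero t), zero_add,
    Finset.sum_map]
  refine Finset.sum_congr rfl fun s _ => ?_
  rw [Finset.sum_map]
  refine Finset.sum_congr rfl fun t _ => if_congr (Fin.succ_lt_succ_iff) ?_ rfl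
  rw [Finset.card_filter_lt_insert_map_succEmb, Finset.card_filter_lt_map_succEmb,
    List.getD_cons_succ]

theorem shuffleSign_map (qs : List ℕ) (r : ℕ) (rs : List ℕ) {N : ℕ} (S : Finset (Fin N))
    (hS : S.card = qs.length) :
    shuffleSign qs (r :: rs) (S.map (Fin.succEmb N)) =
      shuffleSign qs rs S + ((r : ℤ) - 1) * ((qs.sum : ℤ) - qs.length) := by
  rw [← List.sum_range_getD_sub_one, ← hS,
    ← Finset.sum_card_filter_lt S fun i => (((qs.getD i 0 : ℕ) : ℤ) - 1), Finset.mul_sum]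
  simp only [shuffleSign, Finset.compl_map_succEmb]
  rw [Finset.sum_map]
  refine Eq.trans ?_ Finset.sum_add_distrib
  refine Finset.sum_congr rfl fun s _ => ?_
  rw [Finset.sum_insert (by simp), add_comm (ite _ _ _), Finset.sum_map]
  congr 1
  · refine Finset.sum_congr rfl fun t _ => if_congr (Fin.succ_lt_succ_iff) ?_ rfl
    rw [Finset.card_filter_lt_insert_map_succEmb, Finset.card_filter_lt_map_succEmb,
      List.getD_cons_succ]
  · rw [if_pos (show 0 < Fin.succEmb N s from Fin.succ_pos s), Finset.card_filter_lt_map_succEmb,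
      Finset.filter_false_of_mem fun t _ => Fin.not_lt_zero t, Finset.card_empty,
      List.getD_cons_zero, mul_comm]

theorem interleave_succ {α : Type} (f : ℕ → Bool) (i : ℕ) (bs ys : List α) :
    interleave f (i + 1) bs ys = interleave (fun j => f (j + 1)) i bs ys := by
  induction i, bs, ys using interleave.induct (f := fun j => f (j + 1)) with
  | case1 i ys => simp [interleave]
  | case2 i b bs => simp [interleave]
  | case3 i b bs y ys h ih => simp [interleave, h, ih]
  | case4 i b bs y ys h ih => simp [interleave, h, ih]

theorem finsetIndicator_insert_succ {N : ℕ} (S : Finset (Fin N)) :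
    (fun j => finsetIndicator (insert 0 (S.map (Fin.succEmb N))) (j + 1)) =
      finsetIndicator S := by
  funext j
  by_cases h : j < N
  · simp only [finsetIndicator, dif_pos h, dif_pos (Nat.succ_lt_succ h)]
    refine decide_eq_decide.2 ?_
    rw [show (⟨j + 1, Nat.succ_lt_succ h⟩ : Fin (N + 1)) = Fin.succEmb N ⟨j, h⟩ from rfl,
      Finset.mem_insert, Finset.mem_map']
    exact or_iff_right (Fin.succ_ne_zero ⟨j, h⟩)
  · simp [finsetIndicator, h]

theorem finsetIndicator_map_succ {N : ℕ} (S : Finset (Fin N)) :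
    (fun j => finsetIndicator (S.map (Fin.succEmb N)) (j + 1)) = finsetIndicator S := by
  funext j
  by_cases h : j < N
  · simp only [finsetIndicator, dif_pos h, dif_pos (Nat.succ_lt_succ h)]
    refine decide_eq_decide.2 ?_
    rw [show (⟨j + 1, Nat.succ_lt_succ h⟩ : Fin (N + 1)) = Fin.succEmb N ⟨j, h⟩ from rfl]
    exact Finset.mem_map' _
  · simp [finsetIndicator, h]

theorem interleave_insert {α : Type} {N : ℕ} (S : Finset (Fin N)) (b : α) (bs ys : List α) :
    interleave (finsetIndicator (insert 0 (S.map (Fin.succEmb N)))) 0 (b :: bs) ys =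
      b :: interleave (finsetIndicator S) 0 bs ys := by
  cases ys with
  | nil => cases bs <;> simp [interleave]
  | cons y ys =>
    rw [interleave, if_pos (by simp [finsetIndicator]), interleave_succ,
      finsetIndicator_insert_succ]

theorem interleave_map {α : Type} {N : ℕ} (S : Finset (Fin N)) (bs : List α) (y : α)
    (ys : List α) :
    interleave (finsetIndicator (S.map (Fin.succEmb N))) 0 bs (y :: ys) =
      y :: interleave (finsetIndicator S) 0 bs ys := by
  cases bs with
  | nil => simp [interleave]
  | cons b bs =>
    rw [interleave, if_neg (by simp [finsetIndicator]), interleave_succ,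
      finsetIndicator_map_succ]

theorem mem_interleave {α : Type} (f : ℕ → Bool) (i : ℕ) (bs ys : List α) (x : α) :
    x ∈ interleave f i bs ys ↔ x ∈ bs ∨ x ∈ ys := by
  induction i, bs, ys using interleave.induct (f := f) with
  | case1 i ys => simp [interleave]
  | case2 i b bs => simp [interleave]
  | case3 i b bs y ys h ih => simp [interleave, h, ih]; tauto
  | case4 i b bs y ys h ih => simp [interleave, h, ih]; tauto

theorem eps_succ (p q : ℕ) (qs : List ℕ) (i : ℕ) :
    eps p (q :: qs) (i + 1) = (q : ℤ) - 1 + eps p qs i := by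
  simp only [eps, List.take_succ_cons, List.sum_cons]; push_cast; ring

theorem eps_eq_add (p : ℕ) (qs : List ℕ) (i : ℕ) : eps p qs i = p + eps 0 qs i := by
  simp [eps]; ring

theorem ZMod.two_sub_one (x : ZMod 2) : x - 1 = x + 1 := by revert x; decide

namespace BarTail

theorem par_eq {B C : CDGA k} (t : BarTail B C) :
    t.par = (((t.degs.sum : ℤ) - t.degs.length : ℤ) : ZMod 2) + t.last.par := by
  induction t with
  | nil c => simp [par, degs, last]
  | cons b t ih =>
    simp only [par, ih, degs, last, List.sum_cons, List.length_cons, CDGA.Homog.par]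
    push_cast
    rw [← ZMod.two_sub_one]
    ring

end BarTail

namespace BarData

variable {A B C : CDGA k} {fA : CDGAHom B A} {fC : CDGAHom B C} (X : BarData A B C fA fC)

open BarTail

theorem evalL_gen (a : A.carrier) (t : BarTail B C) (p : List B.carrier) :
    X.evalL a t.gen p = X.ι a (p ++ t.word) t.last.val := by
  simp [evalL]

theorem shiftL_apply (b : B.carrier) (F : List B.carrier → X.Bar) (p : List B.carrier) :
    X.shiftL b F p = F (p ++ [b]) := rfl

theorem evalL_dGen (a : A.carrier) (t : BarTail B C) (p : List B.carrier) :
    X.evalL a (dGen t) p =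
      ∑ i ∈ Finset.range t.word.length, ((-1 : k) ^ (eps 0 t.degs i + 1)) •
        X.ι a (p ++ modifyAt (fun b => B.d b) t.word i) t.last.val +
      ((-1 : k) ^ (eps 0 t.degs t.word.length)) • X.ι a (p ++ t.word) (C.d t.last.val) := by
  induction t generalizing p with
  | nil c => simp [dGen, evalL_gen, word, last, degs, eps]
  | cons b t ih =>
    simp only [dGen, map_add, map_neg, map_smul, evalL_consL, Pi.add_apply, Pi.neg_apply,
      Pi.smul_apply, shiftL_apply, ih, evalL_gen, word, last, degs, List.length_cons,
      Finset.sum_range_succ', modifyAt, eps_succ, smul_add, Finset.smul_sum, smul_smul,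
      neg_one_zpow_eq_paritySign, ← paritySign_add, List.append_assoc, List.singleton_append]
    push_cast
    simp only [ZMod.two_sub_one, CDGA.Homog.par, add_assoc]
    simp [eps]
    abel

theorem evalL_deltaGen (a : A.carrier) (b : B.Homog) (t : BarTail B C) (p : List B.carrier) :
    -X.evalL a (deltaGen fC (cons b t)) p =
      ∑ i ∈ Finset.range t.word.length, ((-1 : k) ^ (eps 0 (b.deg :: t.degs) (i + 1))) •
        X.ι a (p ++ mergeAt (· * ·) (b.val :: t.word) i) t.last.val +
      ((-1 : k) ^ (eps 0 (b.deg :: t.degs) t.word.length + 1)) •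
        X.ι a (p ++ (b.val :: t.word).dropLast)
          (fC.toHom ((b.val :: t.word).getLast (List.cons_ne_nil _ _)) * t.last.val) := by
  induction t generalizing b p with
  | nil c =>
    simp [deltaGen, mergeGen, evalL_gen, word, last, degs, eps, smul_smul, ← paritySign_add,
      CharTwo.add_self_eq_zero]
  | cons b' t ih =>
    rw [deltaGen]
    simp only [map_add, map_smul, evalL_consL, Pi.add_apply,
      Pi.smul_apply, shiftL_apply, neg_add]
    rw [← smul_neg (paritySign k (b.par + 1)), ih]
    simp only [mergeGen, evalL_gen, word, last, degs, List.length_cons,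
      Finset.sum_range_succ', mergeAt, eps_succ, smul_add, Finset.smul_sum, smul_smul,
      neg_one_zpow_eq_paritySign, ← paritySign_add, List.append_assoc, List.singleton_append]
    push_cast
    simp only [ZMod.two_sub_one, CDGA.Homog.par, add_assoc]
    simp [eps, paritySign_add]
    abel

theorem evalL_shuffle (a : A.carrier) (N m : ℕ) (t s : BarTail B C)
    (hN : t.word.length + s.word.length = N) (hm : t.word.length = m) (p : List B.carrier) :
    X.evalL a (shuffle t s) p =
      ∑ S : Finset (Fin N) with S.card = m,
        paritySign k (t.last.par * (s.par - s.last.par) + (shuffleSign t.degs s.degs S : ℤ)) •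
          X.ι a (p ++ interleave (finsetIndicator S) 0 t.word s.word)
            (t.last.val * s.last.val) := by
  induction t, s using shuffle.induct generalizing N m p with
  | case1 c z =>
    subst hN hm
    have : (Finset.univ.filter fun S : Finset (Fin 0) => S.card = 0) = {∅} := by decide
    change _ = ∑ S ∈ Finset.univ.filter (fun S : Finset (Fin 0) => S.card = 0), _
    rw [this, Finset.sum_singleton]
    simp [shuffle, evalL_gen, word, last, degs, shuffleSign, interleave, par]
  | case2 c y s ih =>
    obtain _ | N := N
    · simp [word] at hN
    obtain rfl : 0 = m := hm
    rw [Finset.sum_card_eq_zero_fin_succ, shuffle, map_smul, evalL_consL, Pi.smul_apply,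
      shiftL_apply, ih N 0 (by simpa [word] using hN) rfl, Finset.smul_sum]
    refine Finset.sum_congr rfl fun S hS => ?_
    rw [smul_smul, ← paritySign_add, word, word, degs, degs, interleave_map,
      shuffleSign_map _ _ _ _ (by simpa using hS)]
    simp only [List.append_assoc, List.singleton_append, List.sum_nil, List.length_nil, last, par]
    congr 2
    push_cast
    ring
  | case3 b t z ih =>
    obtain _ | N := N
    · simp [word] at hN
    obtain _ | m := m
    · simp [word] at hm
    have hlt : N < m + 1 := by
      simp only [word, List.length_cons, List.length_nil] at hN hm
      omega
    rw [Finset.sum_card_eq_succ_fin_succ, shuffle, evalL_consL, shiftL_apply,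
      ih N m (by simpa [word] using hN) (by simpa [word] using hm),
      Finset.sum_card_eq_of_lt (m := m + 1) hlt, add_zero]
    refine Finset.sum_congr rfl fun S hS => ?_
    simp only [word, degs, last, par, interleave_insert, shuffleSign_insert,
      List.append_assoc, List.singleton_append]
  | case4 b t y s ih₁ ih₂ =>
    obtain _ | N := N
    · simp [word] at hN
    obtain _ | m := m
    · simp [word] at hm
    rw [Finset.sum_card_eq_succ_fin_succ, shuffle, map_add, map_smul, evalL_consL, evalL_consL,
      Pi.add_apply, Pi.smul_apply, shiftL_apply, shiftL_apply,
      ih₁ N m (by simp only [word, List.length_cons] at hN ⊢; omega) (by simpa [word] using hm),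
      ih₂ N (m + 1) (by simp only [word, List.length_cons] at hN ⊢; omega) hm, Finset.smul_sum]
    refine congrArg₂ _ (Finset.sum_congr rfl fun S hS => ?_) (Finset.sum_congr rfl fun S hS => ?_)
    · simp only [word, degs, last, interleave_insert, shuffleSign_insert,
        List.append_assoc, List.singleton_append]
    · have ht := par_eq (cons b t)
      rw [smul_smul, ← paritySign_add, word.eq_2 y, degs.eq_2 y, interleave_map,
        shuffleSign_map _ _ _ _ (by rw [length_degs, hm]; exact (Finset.mem_filter.1 hS).2)]
      simp only [List.append_assoc, List.singleton_append, last]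
      congr 2
      push_cast at ht ⊢
      rw [← ZMod.two_sub_one y.par, show y.par = (y.deg : ZMod 2) from rfl,
        show b.par + 1 + t.par = (cons b t).par from rfl, ht]
      simp only [par, last, CDGA.Homog.par]
      rw [← ZMod.two_sub_one (y.deg : ZMod 2)]
      ring

end BarData

namespace BarData

variable {A B C : CDGA k} {fA : CDGAHom B A} {fC : CDGAHom B C} (X : BarData A B C fA fC)

open BarTail

/-! ### The bar complex in terms of tails -/

theorem evalL_add (a a' : A.carrier) (Y : TailModule B C) :
    X.evalL (a + a') Y = X.evalL a Y + X.evalL a' Y := by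
  have : X.evalL (a + a') = X.evalL a + X.evalL a' := hom_ext fun t => by
    ext p; simp [evalL_gen, X.ι_add_left]
  exact LinearMap.congr_fun this Y

theorem evalL_smul (r : k) (a : A.carrier) (Y : TailModule B C) :
    X.evalL (r • a) Y = r • X.evalL a Y := by
  have : X.evalL (r • a) = r • X.evalL a := hom_ext fun t => by
    ext p; simp [evalL_gen, X.ι_smul_left]
  exact LinearMap.congr_fun this Y

/-- The element `(a, t)` of the bar complex, bilinearly extended. -/
noncomputable def pureL : A.carrier →ₗ[k] TailModule B C →ₗ[k] X.Bar :=
  LinearMap.mk₂ k (fun a Y => X.evalL a Y [])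
    (fun a a' Y => by rw [evalL_add, Pi.add_apply]) (fun r a Y => by rw [evalL_smul, Pi.smul_apply])
    (fun a Y Z => by rw [map_add, Pi.add_apply]) (fun r a Y => by rw [map_smul, Pi.smul_apply])

theorem pureL_apply (a : A.carrier) (Y : TailModule B C) : X.pureL a Y = X.evalL a Y [] := rfl

theorem pureL_gen (a : A.carrier) (t : BarTail B C) :
    X.pureL a t.gen = X.ι a t.word t.last.val := by
  rw [pureL_apply, evalL_gen, List.nil_append]

/-- The part of the bar differential multiplying the first letter into `A`, on tails. -/
noncomputable def headGen (a : A.carrier) : BarTail B C → X.Bar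
  | nil _ => 0
  | cons b t => X.pureL (a * fA.toHom b.val) t.gen

/-- The linear extension of `headGen`. -/
noncomputable def headL (a : A.carrier) : TailModule B C →ₗ[k] X.Bar := lift (X.headGen a)

@[simp] theorem headL_nil (a : A.carrier) (c : C.Homog) : X.headL a (nil c).gen = 0 := by
  simp [headL, headGen]

theorem headL_consL (a : A.carrier) (b : B.Homog) (Y : TailModule B C) :
    X.headL a (consL b Y) = X.pureL (a * fA.toHom b.val) Y := by
  have : X.headL a ∘ₗ consL b = X.pureL (a * fA.toHom b.val) :=
    hom_ext fun t => by simp [headL, headGen]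
  exact LinearMap.congr_fun this Y

theorem headL_mergeL (a : A.carrier) (b : B.Homog) (Y : TailModule B C) :
    X.headL a (mergeL fC b Y) = X.headL (a * fA.toHom b.val) Y := by
  have : X.headL a ∘ₗ mergeL fC b = X.headL (a * fA.toHom b.val) := by
    refine hom_ext fun t => ?_
    cases t with
    | nil c => simp [mergeL_nil]
    | cons b' t =>
      simp only [LinearMap.comp_apply, ← consL_gen, mergeL_consL, headL_consL]
      simp [mul_assoc]
  exact LinearMap.congr_fun this Y

theorem dBar_pureL_gen (a : A.Homog) (t : BarTail B C) :
    X.dBar (X.pureL a.val t.gen) =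
      X.pureL (A.d a.val) t.gen + paritySign k a.par • X.pureL a.val (dGen t) := by
  rw [pureL_gen, X.dBar_eq a.mem t.listHomog t.last.mem, pureL_gen, pureL_apply, evalL_dGen]
  simp only [neg_one_zpow_eq_paritySign, eps_eq_add a.deg, List.nil_append, smul_add,
    Finset.smul_sum, smul_smul, ← paritySign_add, add_assoc]
  push_cast
  simp only [CDGA.Homog.par]

theorem δBar_pureL_gen (a : A.Homog) (t : BarTail B C) :
    X.δBar (X.pureL a.val t.gen) =
      paritySign k a.par • (X.pureL a.val (deltaGen fC t) - X.headL a.val t.gen) := by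
  cases t with
  | nil c => simp [pureL_gen, word, X.δBar_nil, deltaGen]
  | cons b t =>
    rw [pureL_gen, ← neg_inj, word, last,
      X.δBar_eq a.mem b.mem t.listHomog t.last.mem, ← consL_gen, headL_consL, pureL_gen,
      ← smul_neg, neg_sub, sub_eq_add_neg, pureL_apply, evalL_deltaGen]
    have hIcc : Finset.Icc 1 t.word.length = Finset.Ico (0 + 1) (t.word.length + 1) := rfl
    rw [hIcc, ← Finset.sum_Ico_add', ← Finset.range_eq_Ico]
    simp only [neg_one_zpow_eq_paritySign, eps_eq_add a.deg, List.nil_append, smul_add,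
      Finset.smul_sum, smul_smul, ← paritySign_add, add_assoc]
    push_cast
    simp only [CDGA.Homog.par]

theorem D_pureL (a : A.Homog) (Y : TailModule B C) :
    X.D (X.pureL a.val Y) = X.pureL (A.d a.val) Y +
      paritySign k a.par • (X.pureL a.val (diffL fC Y) - X.headL a.val Y) := by
  have : X.D ∘ₗ X.pureL a.val = X.pureL (A.d a.val) +
      paritySign k a.par • (X.pureL a.val ∘ₗ diffL fC - X.headL a.val) := by
    refine hom_ext fun t => ?_
    simp only [D, LinearMap.comp_apply, LinearMap.add_apply, dBar_pureL_gen, δBar_pureL_gen,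
      LinearMap.smul_apply, LinearMap.sub_apply, diffL, lift_gen, map_add, smul_add, smul_sub]
    abel
  exact LinearMap.congr_fun this Y

theorem D_headL (a : A.Homog) (Y : TailModule B C) :
    X.D (X.headL a.val Y) = X.headL (A.d a.val) Y -
      paritySign k a.par • X.headL a.val (diffL fC Y) := by
  have : X.D ∘ₗ X.headL a.val = X.headL (A.d a.val) -
      paritySign k a.par • (X.headL a.val ∘ₗ diffL fC) := by
    refine hom_ext fun t => ?_
    cases t with
    | nil c => simp [diffL_nil]
    | cons b t =>
      simp only [LinearMap.comp_apply, LinearMap.sub_apply, LinearMap.smul_apply, ← consL_gen,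
        headL_consL, diffL_consL, map_add, map_neg, map_smul, headL_mergeL]
      have := X.D_pureL (a * b.map fA) t.gen
      simp only [CDGA.Homog.mul_val, CDGA.Homog.map_val, CDGA.Homog.d_mul_val,
        CDGA.Homog.mul_par, CDGA.Homog.map_par, map_add, map_smul, LinearMap.add_apply,
        LinearMap.smul_apply] at this
      rw [this, CDGA.Homog.d_val, fA.map_d]
      simp only [paritySign_add, paritySign_one, smul_add, smul_sub, smul_neg, mul_smul, neg_smul,
        mul_neg, mul_one]
      abel
  exact LinearMap.congr_fun this Y

theorem mul_pureL (a x : A.Homog) (Y Z : TailModule B C) :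
    X.mul (X.pureL a.val Y) (X.pureL x.val Z) =
      X.pureL (a * x).val (mulL (signL x.par Y) Z) := by
  have : X.mul.compl₁₂ (X.pureL a.val) (X.pureL x.val) =
      (mulL ∘ₗ signL x.par).compr₂ (X.pureL (a * x).val) := by
    refine hom_ext₂ fun t s => ?_
    simp only [LinearMap.compl₁₂_apply, LinearMap.compr₂_apply, LinearMap.comp_apply, signL_gen,
      map_smul, LinearMap.smul_apply, mulL_gen]
    rw [pureL_gen, pureL_gen, pureL_apply, X.evalL_shuffle _ _ _ t s rfl rfl,
      X.mul_eq a.mem t.listHomog t.last.mem x.mem s.listHomog s.last.mem, Finset.smul_sum]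
    refine Finset.sum_congr rfl fun S _ => ?_
    rw [neg_one_zpow_eq_paritySign, smul_smul, ← paritySign_add, par_eq t, par_eq s, etaSign,
      List.nil_append, CDGA.Homog.mul_val]
    congr 2
    push_cast
    simp only [CDGA.Homog.par]
    ring
  exact LinearMap.congr_fun (LinearMap.congr_fun this Y) Z

theorem D_D_pureL (a : A.Homog) (Y : TailModule B C) : X.D (X.D (X.pureL a.val Y)) = 0 := by
  have hd : X.D (X.pureL (A.d a.val) Y) = _ := X.D_pureL a.d Y
  have h2 : X.pureL a.val (diffL fC (diffL fC Y)) = 0 := by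
    rw [pureL_apply, evalL_diffL_diffL, Pi.zero_apply]
  simp only [D_pureL, D_headL, hd, h2, map_add, map_sub, map_smul, CDGA.Homog.d_val, A.d_sq,
    CDGA.Homog.d_par, map_zero, LinearMap.zero_apply]
  rcases ZMod.two_cases a.par with h | h <;> simp [h]
  abel

theorem headL_mulL (a x : A.Homog) (t s : BarTail B C) :
    X.headL (a * x).val (mulL (signL x.par t.gen) s.gen) =
      paritySign k x.par • X.mul (X.headL a.val t.gen) (X.pureL x.val s.gen) +
        paritySign k t.par • X.mul (X.pureL a.val t.gen) (X.headL x.val s.gen) := by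
  have hleft : ∀ (b : B.Homog) (Y Z : TailModule B C),
      X.mul (X.pureL (a.val * fA.toHom b.val) Y) (X.pureL x.val Z) =
        paritySign k (b.par * x.par) •
          X.pureL (a.val * x.val * fA.toHom b.val) (mulL (signL x.par Y) Z) := fun b Y Z => by
    have := X.mul_pureL (a * b.map fA) x Y Z
    rw [CDGA.Homog.mul_assoc, CDGA.Homog.mul_val, CDGA.Homog.mul_val,
      CDGA.Homog.mul_val, CDGA.Homog.mul_comm_val (b.map fA) x, mul_smul_comm, map_smul,
      LinearMap.smul_apply, ← mul_assoc] at this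
    exact this
  have hright : ∀ (y : B.Homog) (Y Z : TailModule B C),
      X.mul (X.pureL a.val Y) (X.pureL (x.val * fA.toHom y.val) Z) =
        X.pureL (a.val * x.val * fA.toHom y.val) (mulL (signL (x.par + y.par) Y) Z) :=
      fun y Y Z => by
    have := X.mul_pureL a (x * y.map fA) Y Z
    rw [CDGA.Homog.mul_par, CDGA.Homog.map_par, ← CDGA.Homog.mul_assoc] at this
    exact this
  cases t with
  | nil c =>
    cases s with
    | nil z => simp [signL_gen, mulL_nil_nil]
    | cons y s =>
      simp only [← consL_gen, headL_consL, headL_nil, map_zero, LinearMap.zero_apply, smul_zero,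
        zero_add, hright, signL_gen, map_smul, LinearMap.smul_apply, mulL_nil_consL, smul_smul,
        ← paritySign_add, par, CDGA.Homog.mul_val]
      congr 2
      generalize c.par = u, x.par = v, y.par = w
      decide +revert
  | cons b t =>
    cases s with
    | nil z =>
      simp only [← consL_gen, headL_consL, headL_nil, map_zero, smul_zero,
        add_zero, hleft, signL_consL, signL_gen, map_smul, LinearMap.smul_apply, mulL_consL_nil,
        smul_smul, ← paritySign_add, par, CDGA.Homog.mul_val]
      congr 2
      generalize b.par = u, x.par = v, t.par = w
      decide +revert
    | cons y s =>
      simp only [← consL_gen, headL_consL, hleft, hright, signL_consL, signL_gen, map_smul,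
        LinearMap.smul_apply, mulL_consL_consL, smul_smul, ← paritySign_add, par,
        CDGA.Homog.mul_val, map_add, smul_add]
      congr 2
      all_goals
        congr 1
        generalize b.par = u, x.par = v, t.par = w, y.par = z
        decide +revert

theorem D_mul_pureL (a x : A.Homog) (t s : BarTail B C) :
    X.D (X.mul (X.pureL a.val t.gen) (X.pureL x.val s.gen)) =
      X.mul (X.D (X.pureL a.val t.gen)) (X.pureL x.val s.gen) +
        paritySign k (a.par + t.par) •
          X.mul (X.pureL a.val t.gen) (X.D (X.pureL x.val s.gen)) := by
  have hda : X.mul (X.pureL (A.d a.val) t.gen) (X.pureL x.val s.gen) = _ :=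
    X.mul_pureL a.d x t.gen s.gen
  have hdx : X.mul (X.pureL a.val t.gen) (X.pureL (A.d x.val) s.gen) = _ :=
    X.mul_pureL a x.d t.gen s.gen
  have hL : X.pureL (a * x).val (diffL fC (mulL t.gen s.gen)) = _ :=
    congrFun (X.evalL_diffL_mulL_gen (a * x).val t s) []
  rw [← pureL_apply, map_add, CDGA.Homog.mul_val] at hL
  have hh := X.headL_mulL a x t s
  rw [mul_pureL, D_pureL, D_pureL, D_pureL, hh]
  simp only [map_add, map_sub, map_smul, LinearMap.add_apply, LinearMap.sub_apply,
    LinearMap.smul_apply, hda, hdx, mul_pureL, signL_gen, hL, signL_diffL,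
    CDGA.Homog.mul_val, CDGA.Homog.d_val, CDGA.Homog.d_mul_val, CDGA.Homog.mul_par,
    CDGA.Homog.d_par]
  rcases ZMod.two_cases a.par with h | h <;> rcases ZMod.two_cases x.par with h' | h' <;>
    rcases ZMod.two_cases t.par with ht | ht <;> simp [h, h', ht] <;> abel

theorem mul_assoc_pureL (a x w : A.Homog) (Y Z V : TailModule B C) :
    X.mul (X.mul (X.pureL a.val Y) (X.pureL x.val Z)) (X.pureL w.val V) =
      X.mul (X.pureL a.val Y) (X.mul (X.pureL x.val Z) (X.pureL w.val V)) := by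
  rw [mul_pureL, mul_pureL, mul_pureL, mul_pureL, CDGA.Homog.mul_assoc, signL_mulL, signL_signL,
    mulL_assoc, CDGA.Homog.mul_par, add_comm w.par]

theorem mul_comm_pureL (a x : A.Homog) (t s : BarTail B C) :
    X.mul (X.pureL a.val t.gen) (X.pureL x.val s.gen) =
      paritySign k ((a.par + t.par) * (x.par + s.par)) •
        X.mul (X.pureL x.val s.gen) (X.pureL a.val t.gen) := by
  have h : X.pureL (a * x).val (mulL t.gen s.gen) = _ :=
    congrFun (X.evalL_mulL_comm (a * x).val t s) []
  rw [Pi.smul_apply, ← pureL_apply, CDGA.Homog.mul_val, CDGA.Homog.mul_comm_val, map_smul,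
    LinearMap.smul_apply, LinearMap.smul_apply] at h
  rw [mul_pureL, mul_pureL, signL_gen, signL_gen]
  simp only [map_smul, LinearMap.smul_apply]
  rw [CDGA.Homog.mul_val, CDGA.Homog.mul_comm_val, map_smul,
    LinearMap.smul_apply, h, CDGA.Homog.mul_val]
  simp only [smul_smul, ← paritySign_add]
  congr 2
  generalize a.par = u, x.par = v, t.par = w, s.par = z
  decide +revert

end BarData

theorem insertAt_length_append {α : Type} (x : α) (l₁ l₂ : List α) :
    insertAt x l₁.length (l₁ ++ l₂) = l₁ ++ x :: l₂ := by
  induction l₁ with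
  | nil => cases l₂ <;> rfl
  | cons a l ih => simp [insertAt, ih]

theorem mem_insertAt {α : Type} (x : α) (i : ℕ) (l : List α) : x ∈ insertAt x i l := by
  induction l generalizing i with
  | nil => cases i <;> simp [insertAt]
  | cons a l ih => cases i <;> simp [insertAt, ih]

namespace BarData

variable {A B C : CDGA k} {fA : CDGAHom B A} {fC : CDGAHom B C} (X : BarData A B C fA fC)

open BarTail

/-! ### Homogeneous pure tensors -/

/-- The span of the homogeneous pure tensors, required to have an entry in `B⁰` if `P` holds. -/
def pureSpan (P : Prop) : Submodule k X.Bar :=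
  Submodule.span k {u | ∃ (a : A.Homog) (t : BarTail B C),
    (P → ∃ f ∈ B.grading 0, f ∈ t.word) ∧ u = X.pureL a.val t.gen}

theorem evalL_gen_mem_pureSpan {P : Prop} (a : A.Homog) (t : BarTail B C) (p : List B.carrier)
    (h : P → ∃ f ∈ B.grading 0, f ∈ p ++ t.word) : X.evalL a.val t.gen p ∈ X.pureSpan P := by
  induction p using List.reverseRecOn generalizing t with
  | nil => exact Submodule.subset_span ⟨a, t, h, rfl⟩
  | append_singleton p b ih =>
    by_cases hb : b ∈ B.grading 0
    · have := ih (cons ⟨0, b, hb⟩ t) (by simpa [word] using h)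
      rwa [← consL_gen, evalL_consL] at this
    · have h' : ∀ b' : B.Homog, P → ∃ f ∈ B.grading 0, f ∈ p ++ (cons b' t).word :=
        fun b' hP => by
        obtain ⟨f, hf, hfm⟩ := h hP
        refine ⟨f, hf, ?_⟩
        have : f ≠ b := fun e => hb (e ▸ hf)
        simp only [List.mem_append, word, List.mem_cons] at hfm ⊢
        tauto
      clear hb h
      change X.letterL a.val t.gen b p ∈ _
      induction b using DirectSum.Decomposition.inductionOn B.grading with
      | zero => simp
      | @homogeneous i b =>
        have := ih (cons ⟨i, b, b.2⟩ t) (h' _)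
        rwa [← consL_gen, evalL_consL] at this
      | add b b' hb hb' =>
        rw [map_add, Pi.add_apply]
        exact add_mem hb hb'

theorem ι_mem_pureSpan {P : Prop} (a : A.carrier) (l : List B.carrier) (c : C.carrier)
    (h : P → ∃ f ∈ B.grading 0, f ∈ l) : X.ι a l c ∈ X.pureSpan P := by
  change X.endL a c l ∈ _
  induction c using DirectSum.Decomposition.inductionOn C.grading with
  | zero => simp
  | @homogeneous i c =>
    change X.ι a l c ∈ _
    have e : ∀ a, X.ι a l c = X.evalL a (nil ⟨i, c, c.2⟩ : BarTail B C).gen l := fun a => by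
      simp [evalL_gen, word, last]
    induction a using DirectSum.Decomposition.inductionOn A.grading with
    | zero => rw [← zero_smul k (0 : A.carrier), X.ι_smul_left, zero_smul]; exact zero_mem _
    | @homogeneous j a =>
      rw [e]
      exact X.evalL_gen_mem_pureSpan ⟨j, a, a.2⟩ _ _ (by simpa [word] using h)
    | add a a' ha ha' => rw [X.ι_add_left]; exact add_mem ha ha'
  | add c c' hc hc' => rw [map_add, Pi.add_apply]; exact add_mem hc hc'

theorem pure_induction {P : X.Bar → Prop} (zero : P 0) (add : ∀ u v, P u → P v → P (u + v))
    (smul : ∀ (r : k) u, P u → P (r • u))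
    (pure : ∀ (a : A.Homog) (t : BarTail B C), P (X.pureL a.val t.gen)) (u : X.Bar) : P u := by
  have hu : u ∈ X.pureSpan False := by
    have : (⊤ : Submodule k X.Bar) ≤ X.pureSpan False := by
      rw [← X.span_ι, Submodule.span_le]
      rintro _ ⟨a, l, c, rfl⟩
      exact X.ι_mem_pureSpan a l c False.elim
    exact this trivial
  refine Submodule.span_induction ?_ zero (fun u v _ _ => add u v) (fun r u _ => smul r u) hu
  rintro _ ⟨a, t, -, rfl⟩
  exact pure a t

/-- The total degree of a homogeneous pure tensor. -/
def pureDeg (a : A.Homog) (t : BarTail B C) : ℤ :=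
  a.deg + t.degs.sum - t.word.length + t.last.deg

theorem pureL_mem_grading (a : A.Homog) (t : BarTail B C) :
    X.pureL a.val t.gen ∈ X.grading (pureDeg a t) := by
  rw [pureL_gen]
  exact X.ι_mem a.mem t.listHomog t.last.mem

theorem cast_pureDeg (a : A.Homog) (t : BarTail B C) :
    (pureDeg a t : ZMod 2) = a.par + t.par := by
  rw [par_eq, length_degs, pureDeg]
  push_cast
  simp only [CDGA.Homog.par]
  ring

theorem grading_le_span (m : ℤ) : X.grading m ≤ Submodule.span k
    {u | ∃ (a : A.Homog) (t : BarTail B C), pureDeg a t = m ∧ u = X.pureL a.val t.gen} := by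
  intro u hu
  rw [← DirectSum.decompose_of_mem_same _ hu]
  clear hu
  induction u using X.pure_induction with
  | zero => simp
  | add u v hu hv =>
    rw [DirectSum.decompose_add, DirectSum.add_apply, Submodule.coe_add]
    exact add_mem hu hv
  | smul r u hu =>
    rw [DirectSum.decompose_smul, DirectSum.smul_apply, Submodule.coe_smul]
    exact Submodule.smul_mem _ _ hu
  | pure a t =>
    by_cases h : pureDeg a t = m
    · rw [DirectSum.decompose_of_mem_same _ (h ▸ X.pureL_mem_grading a t)]
      exact Submodule.subset_span ⟨a, t, h, rfl⟩
    · rw [DirectSum.decompose_of_mem_ne _ (X.pureL_mem_grading a t) h]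
      exact zero_mem _

/-! ### The bar complex is a differential graded algebra -/

theorem D_D (u : X.Bar) : X.D (X.D u) = 0 := by
  induction u using X.pure_induction with
  | zero => simp
  | add u v hu hv => simp [hu, hv]
  | smul r u hu => simp [hu]
  | pure a t => exact X.D_D_pureL a _

theorem mul_assoc (u v w : X.Bar) : X.mul (X.mul u v) w = X.mul u (X.mul v w) := by
  induction u using X.pure_induction with
  | zero => simp
  | add u u' hu hu' => simp [hu, hu']
  | smul r u hu => simp [hu]
  | pure a t =>
    induction v using X.pure_induction with
    | zero => simp
    | add u u' hu hu' => simp [hu, hu']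
    | smul r u hu => simp [hu]
    | pure x s =>
      induction w using X.pure_induction with
      | zero => simp
      | add u u' hu hu' => simp [hu, hu']
      | smul r u hu => simp [hu]
      | pure w r => exact X.mul_assoc_pureL a x w _ _ _

theorem mul_comm_of_mem {m n : ℤ} {u v : X.Bar} (hu : u ∈ X.grading m) (hv : v ∈ X.grading n) :
    X.mul u v = ((-1 : k) ^ (m * n)) • X.mul v u := by
  replace hu := X.grading_le_span m hu
  replace hv := X.grading_le_span n hv
  induction hu using Submodule.span_induction with
  | zero => simp
  | add u u' _ _ hu hu' => simp [hu, hu']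
  | smul r u _ hu => rw [map_smul, map_smul, LinearMap.smul_apply, hu, smul_comm]
  | mem u h =>
    obtain ⟨a, t, rfl, rfl⟩ := h
    induction hv using Submodule.span_induction with
    | zero => simp
    | add u u' _ _ hu hu' => simp [hu, hu']
    | smul r u _ hu => rw [map_smul, map_smul, LinearMap.smul_apply, hu, smul_comm]
    | mem v h =>
      obtain ⟨x, s, rfl, rfl⟩ := h
      rw [mul_comm_pureL, neg_one_zpow_eq_paritySign]
      push_cast
      rw [cast_pureDeg, cast_pureDeg]

theorem D_mul_of_mem {m : ℤ} {u : X.Bar} (hu : u ∈ X.grading m) (v : X.Bar) :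
    X.D (X.mul u v) = X.mul (X.D u) v + ((-1 : k) ^ m) • X.mul u (X.D v) := by
  replace hu := X.grading_le_span m hu
  induction hu using Submodule.span_induction with
  | zero => simp
  | add u u' _ _ hu hu' => simp only [map_add, LinearMap.add_apply, smul_add, hu, hu']; abel
  | smul r u _ hu =>
    simp only [map_smul, LinearMap.smul_apply, hu, smul_add]
    rw [smul_comm]
  | mem u h =>
    obtain ⟨a, t, rfl, rfl⟩ := h
    induction v using X.pure_induction with
    | zero => simp
    | add u u' hu hu' => simp only [map_add, smul_add, hu, hu']; abel
    | smul r u hu =>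
      simp only [map_smul, hu, smul_add]
      rw [smul_comm]
    | pure x s =>
      rw [D_mul_pureL, neg_one_zpow_eq_paritySign, cast_pureDeg]

/-! ### The ideal `W` -/

theorem ins_mem_pureSpan {f : B.carrier} (hf : f ∈ B.grading 0) (i : ℕ) (u : X.Bar) :
    X.ins f i u ∈ X.pureSpan True := by
  have hu : u ∈ Submodule.span k {u : X.Bar | ∃ a l c, u = X.ι a l c} := X.span_ι ▸ trivial
  induction hu using Submodule.span_induction with
  | zero => simp
  | add u v _ _ hu hv => rw [map_add]; exact add_mem hu hv
  | smul r u _ hu => rw [map_smul]; exact Submodule.smul_mem _ _ hu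
  | mem u h =>
    obtain ⟨a, l, c, rfl⟩ := h
    rcases le_or_gt i l.length with hi | hi
    · rw [X.ins_eq hf i a l c hi]
      exact X.ι_mem_pureSpan a _ c fun _ => ⟨f, hf, mem_insertAt f i l⟩
    · rw [X.ins_zero hf i a l c hi]
      exact zero_mem _

theorem exists_ins_eq_pureL (a : A.Homog) {t : BarTail B C}
    (ht : ∃ f ∈ B.grading 0, f ∈ t.word) :
    ∃ f ∈ B.grading 0, ∃ (i : ℕ) (u : X.Bar), X.pureL a.val t.gen = X.ins f i u := by
  obtain ⟨f, hf, hft⟩ := ht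
  obtain ⟨l₁, l₂, h⟩ := List.append_of_mem hft
  refine ⟨f, hf, l₁.length, X.ι a.val (l₁ ++ l₂) t.last.val, ?_⟩
  rw [X.ins_eq hf _ _ _ _ (by simp), insertAt_length_append, ← h, pureL_gen]

theorem W_eq : X.W = X.pureSpan True ⊔ (X.pureSpan True).map X.D := by
  apply le_antisymm
  · refine Submodule.span_le.2 ?_
    rintro _ (⟨f, hf, i, y, rfl⟩ | ⟨f, hf, i, y, rfl⟩)
    · exact Submodule.mem_sup_left (X.ins_mem_pureSpan hf i y)
    · exact sub_mem
        (Submodule.mem_sup_right (Submodule.mem_map_of_mem (X.ins_mem_pureSpan hf i y)))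
        (Submodule.mem_sup_left (X.ins_mem_pureSpan hf i _))
  · have hins : ∀ {f}, f ∈ B.grading 0 → ∀ i y, X.ins f i y ∈ X.W := fun hf i y =>
      Submodule.subset_span (Or.inl ⟨_, hf, i, y, rfl⟩)
    rw [sup_le_iff, Submodule.map_le_iff_le_comap]
    constructor <;> refine Submodule.span_le.2 ?_ <;> rintro _ ⟨a, t, ht, rfl⟩ <;>
      obtain ⟨f, hf, i, u, h⟩ := X.exists_ins_eq_pureL a (ht trivial) <;> rw [h]
    · exact hins hf i u
    · have : X.D (X.ins f i u) - X.ins f i (X.D u) ∈ X.W :=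
        Submodule.subset_span (Or.inr ⟨f, hf, i, u, rfl⟩)
      simpa using add_mem this (hins hf i (X.D u))

theorem D_mem_W {u : X.Bar} (hu : u ∈ X.W) : X.D u ∈ X.W := by
  rw [W_eq] at hu ⊢
  obtain ⟨v, hv, _, ⟨w, -, rfl⟩, rfl⟩ := Submodule.mem_sup.1 hu
  rw [map_add, D_D, add_zero]
  exact Submodule.mem_sup_right (Submodule.mem_map_of_mem hv)

theorem mul_pureL_mem_pureSpan (a x : A.Homog) (t s : BarTail B C)
    (h : ∃ f ∈ B.grading 0, f ∈ t.word ∨ f ∈ s.word) :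
    X.mul (X.pureL a.val t.gen) (X.pureL x.val s.gen) ∈ X.pureSpan True := by
  rw [pureL_gen, pureL_gen,
    X.mul_eq a.mem t.listHomog t.last.mem x.mem s.listHomog s.last.mem]
  refine Submodule.sum_mem _ fun S _ => Submodule.smul_mem _ _ (X.ι_mem_pureSpan _ _ _ fun _ => ?_)
  obtain ⟨f, hf, hfm⟩ := h
  exact ⟨f, hf, (mem_interleave _ _ _ _ _).2 hfm⟩

theorem mul_mem_pureSpan {w : X.Bar} (hw : w ∈ X.pureSpan True) (y : X.Bar) :
    X.mul w y ∈ X.pureSpan True ∧ X.mul y w ∈ X.pureSpan True := by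
  induction hw using Submodule.span_induction with
  | zero => simp
  | add u v _ _ hu hv =>
    simp only [map_add, LinearMap.add_apply]
    exact ⟨add_mem hu.1 hv.1, add_mem hu.2 hv.2⟩
  | smul r u _ hu =>
    simp only [map_smul, LinearMap.smul_apply]
    exact ⟨Submodule.smul_mem _ _ hu.1, Submodule.smul_mem _ _ hu.2⟩
  | mem w h =>
    obtain ⟨a, t, ht, rfl⟩ := h
    obtain ⟨f, hf, hft⟩ := ht trivial
    induction y using X.pure_induction with
    | zero => simp
    | add u v hu hv =>
      simp only [map_add, LinearMap.add_apply]
      exact ⟨add_mem hu.1 hv.1, add_mem hu.2 hv.2⟩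
    | smul r u hu =>
      simp only [map_smul, LinearMap.smul_apply]
      exact ⟨Submodule.smul_mem _ _ hu.1, Submodule.smul_mem _ _ hu.2⟩
    | pure x s =>
      exact ⟨X.mul_pureL_mem_pureSpan _ _ _ _ ⟨f, hf, Or.inl hft⟩,
        X.mul_pureL_mem_pureSpan _ _ _ _ ⟨f, hf, Or.inr hft⟩⟩

theorem mul_D_mem_W {w : X.Bar} (hw : w ∈ X.pureSpan True) (y : X.Bar) :
    X.mul (X.D w) y ∈ X.W ∧ X.mul y (X.D w) ∈ X.W := by
  have hle : X.pureSpan True ≤ X.W := X.W_eq ▸ le_sup_left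
  induction hw using Submodule.span_induction with
  | zero => simp
  | add u v _ _ hu hv =>
    simp only [map_add, LinearMap.add_apply]
    exact ⟨add_mem hu.1 hv.1, add_mem hu.2 hv.2⟩
  | smul r u _ hu =>
    simp only [map_smul, LinearMap.smul_apply]
    exact ⟨Submodule.smul_mem _ _ hu.1, Submodule.smul_mem _ _ hu.2⟩
  | mem w h =>
    have hw : w ∈ X.pureSpan True := Submodule.subset_span h
    obtain ⟨a, t, ht, rfl⟩ := h
    refine ⟨?_, ?_⟩
    · rw [eq_sub_of_add_eq (X.D_mul_of_mem (X.pureL_mem_grading a t) y).symm]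
      exact sub_mem (X.D_mem_W (hle (X.mul_mem_pureSpan hw y).1))
        (Submodule.smul_mem _ _ (hle (X.mul_mem_pureSpan hw _).1))
    · induction y using X.pure_induction with
      | zero => simp
      | add u v hu hv =>
        simp only [map_add, LinearMap.add_apply]
        exact add_mem hu hv
      | smul r u hu =>
        simp only [map_smul, LinearMap.smul_apply]
        exact Submodule.smul_mem _ _ hu
      | pure x s =>
        have h := X.D_mul_of_mem (X.pureL_mem_grading x s) (X.pureL a.val t.gen)
        rw [← sub_eq_iff_eq_add'] at h
        rw [← Submodule.smul_mem_iff _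
          (zpow_ne_zero (pureDeg x s) (neg_ne_zero.2 (one_ne_zero (α := k)))), ← h]
        exact sub_mem (X.D_mem_W (hle (X.mul_mem_pureSpan hw _).2))
          (hle (X.mul_mem_pureSpan hw _).2)

theorem mul_mem_W {w : X.Bar} (hw : w ∈ X.W) (y : X.Bar) :
    X.mul w y ∈ X.W ∧ X.mul y w ∈ X.W := by
  have hle : X.pureSpan True ≤ X.W := X.W_eq ▸ le_sup_left
  rw [W_eq] at hw
  obtain ⟨u, hu, _, ⟨v, hv, rfl⟩, rfl⟩ := Submodule.mem_sup.1 hw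
  simp only [map_add, LinearMap.add_apply]
  exact ⟨add_mem (hle (X.mul_mem_pureSpan hu y).1) (X.mul_D_mem_W hv y).1,
    add_mem (hle (X.mul_mem_pureSpan hu y).2) (X.mul_D_mem_W hv y).2⟩

/-- The shuffle product on the normalized bar complex. -/
noncomputable def mulQuot : (X.Bar ⧸ X.W) →ₗ[k] (X.Bar ⧸ X.W) →ₗ[k] (X.Bar ⧸ X.W) :=
  X.W.liftQ (X.W.liftQ (X.mul.compr₂ X.W.mkQ).flip fun y hy => by
      ext x
      simpa using (X.mul_mem_W hy x).2).flip fun x hx => by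
    rw [LinearMap.mem_ker]
    ext y
    change X.W.mkQ (X.mul x y) = 0
    simpa using (X.mul_mem_W hx y).1

theorem mulQuot_mkQ (x y : X.Bar) :
    X.mulQuot (X.W.mkQ x) (X.W.mkQ y) = X.W.mkQ (X.mul x y) := rfl

end BarData

/-- The subspace `W` of the bar complex `B(A,B,C)` is an ideal with respect to
the shuffle product; consequently the shuffle product descends to a product on Chen's
normalized bar complex `B̄(A,B,C) = B(A,B,C)/W`, making `B̄(A,B,C)` a kCDGA (the descended
product is associative and graded commutative, and the total differential descends to a
square-zero graded derivation for it). -/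
theorem barW_ideal_and_normalized_cdga {k : Type} [Field k] {A B C : CDGA k}
    {fA : CDGAHom B A} {fC : CDGAHom B C} (X : BarData A B C fA fC) :
    (∀ x ∈ X.W, ∀ y : X.Bar, X.mul x y ∈ X.W ∧ X.mul y x ∈ X.W) ∧
    ∃ mulQ : (X.Bar ⧸ X.W) →ₗ[k] (X.Bar ⧸ X.W) →ₗ[k] (X.Bar ⧸ X.W),
      (∀ x y : X.Bar, mulQ (X.W.mkQ x) (X.W.mkQ y) = X.W.mkQ (X.mul x y)) ∧
      (∀ u v w : X.Bar ⧸ X.W, mulQ (mulQ u v) w = mulQ u (mulQ v w)) ∧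
      (∀ (m n : ℤ) (u v : X.Bar ⧸ X.W), u ∈ (X.grading m).map X.W.mkQ →
          v ∈ (X.grading n).map X.W.mkQ → mulQ u v = ((-1 : k) ^ (m * n)) • mulQ v u) ∧
      ∃ DQ : (X.Bar ⧸ X.W) →ₗ[k] (X.Bar ⧸ X.W),
        (∀ x : X.Bar, DQ (X.W.mkQ x) = X.W.mkQ (X.D x)) ∧
        (∀ u, DQ (DQ u) = 0) ∧
        (∀ (m : ℤ) (u v : X.Bar ⧸ X.W), u ∈ (X.grading m).map X.W.mkQ →
            DQ (mulQ u v) = mulQ (DQ u) v + ((-1 : k) ^ m) • mulQ u (DQ v)) := by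
  refine ⟨fun x hx y => X.mul_mem_W hx y, X.mulQuot, X.mulQuot_mkQ, fun u v w => ?_, ?_,
    X.W.mapQ X.W X.D fun u hu => X.D_mem_W hu, fun x => rfl, fun u => ?_, ?_⟩
  · obtain ⟨u, rfl⟩ := X.W.mkQ_surjective u
    obtain ⟨v, rfl⟩ := X.W.mkQ_surjective v
    obtain ⟨w, rfl⟩ := X.W.mkQ_surjective w
    simp only [BarData.mulQuot_mkQ, BarData.mul_assoc]
  · rintro m n _ _ ⟨u, hu, rfl⟩ ⟨v, hv, rfl⟩
    rw [BarData.mulQuot_mkQ, BarData.mulQuot_mkQ, X.mul_comm_of_mem hu hv, map_smul]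
  · obtain ⟨u, rfl⟩ := X.W.mkQ_surjective u
    simp only [Submodule.mkQ_apply, Submodule.mapQ_apply, BarData.D_D, Submodule.Quotient.mk_zero]
  · rintro m _ v ⟨u, hu, rfl⟩
    obtain ⟨v, rfl⟩ := X.W.mkQ_surjective v
    have hD : ∀ x, X.W.mapQ X.W X.D (fun u hu => X.D_mem_W hu) (X.W.mkQ x) = X.W.mkQ (X.D x) :=
      fun x => rfl
    rw [BarData.mulQuot_mkQ, hD, hD, hD, BarData.mulQuot_mkQ, BarData.mulQuot_mkQ,
      X.D_mul_of_mem hu, map_add, map_smul]
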